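/- arXiv:1410.3244 — 2 statements merged into one kernel-verified Lean document; each statement's English description precedes it below -/
import Mathlib

section
/- For every integer r ≥ 0, a pseudo H-type Lie algebra n_{r+4,4} built on a minimal admissible Cl_{r+4,4}-module is isomorphic as a Lie algebra to a pseudo H-type Lie algebra n_{4,r+4} built on a minimal admissible Cl_{4,r+4}-module if and only if r ≡ 0, 1, 2, or 4 (mod 8). -/
/-- The standard scalar product of signature `(r,s)` on `ℝ^(r+s)`:
`⟨Z,W⟩_{r,s} = ∑_{i<r} Z i * W i - ∑_{r ≤ i < r+s} Z i * W i`. -/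
def sform (r s : ℕ) (Z W : Fin (r + s) → ℝ) : ℝ :=
  ∑ i : Fin (r + s), (if (i : ℕ) < r then (1 : ℝ) else -1) * Z i * W i

/-- `(V, B, J)` is an admissible module of the Clifford algebra `Cl_{r,s}`:
`V` is a nonzero finite-dimensional real vector space, `B` a nondegenerate
symmetric bilinear form on `V`, and `J : ℝ^{r+s} → End V` linear with
`J_Z ∘ J_Z = -⟨Z,Z⟩_{r,s} • id` and each `J_Z` skew-adjoint w.r.t. `B`. -/
def IsAdmissible (r s : ℕ) (V : Type) [AddCommGroup V] [Module ℝ V]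
    (B : V →ₗ[ℝ] V →ₗ[ℝ] ℝ)
    (J : (Fin (r + s) → ℝ) →ₗ[ℝ] V →ₗ[ℝ] V) : Prop :=
  FiniteDimensional ℝ V ∧ Nontrivial V ∧
  (∀ v w : V, B v w = B w v) ∧
  (∀ v : V, (∀ w : V, B v w = 0) → v = 0) ∧
  (∀ (Z : Fin (r + s) → ℝ) (v : V), J Z (J Z v) = (-(sform r s Z Z)) • v) ∧
  (∀ (Z : Fin (r + s) → ℝ) (v w : V), B (J Z v) w = -(B v (J Z w)))

/-- A minimal admissible `Cl_{r,s}`-module: one of least possible dimension. -/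
def IsMinimalAdmissible (r s : ℕ) (V : Type) [AddCommGroup V] [Module ℝ V]
    (B : V →ₗ[ℝ] V →ₗ[ℝ] ℝ)
    (J : (Fin (r + s) → ℝ) →ₗ[ℝ] V →ₗ[ℝ] V) : Prop :=
  IsAdmissible r s V B J ∧
  ∀ (V' : Type) [AddCommGroup V'] [Module ℝ V']
    (B' : V' →ₗ[ℝ] V' →ₗ[ℝ] ℝ)
    (J' : (Fin (r + s) → ℝ) →ₗ[ℝ] V' →ₗ[ℝ] V'),
    IsAdmissible r s V' B' J' → Module.finrank ℝ V ≤ Module.finrank ℝ V'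

/-- `br` is the Lie bracket of the pseudo `H`-type Lie algebra `V ⊕ ℝ^{r+s}`
determined by the admissible module `(V,B,J)`, i.e.
`⟨Z, [v,w]⟩_{r,s} = ⟨J_Z v, w⟩_V` for all `Z, v, w`. -/
def IsHBracket (r s : ℕ) (V : Type) [AddCommGroup V] [Module ℝ V]
    (B : V →ₗ[ℝ] V →ₗ[ℝ] ℝ)
    (J : (Fin (r + s) → ℝ) →ₗ[ℝ] V →ₗ[ℝ] V)
    (br : V →ₗ[ℝ] V →ₗ[ℝ] (Fin (r + s) → ℝ)) : Prop :=
  ∀ (Z : Fin (r + s) → ℝ) (v w : V), sform r s Z (br v w) = B (J Z v) w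

/-- A linear equivalence `f` between the pseudo `H`-type Lie algebras
`V₁ ⊕ ℝ^{n₁}` and `V₂ ⊕ ℝ^{n₂}` (with 2-step brackets `br₁`, `br₂`, the
`ℝ^{nᵢ}` factors being central) is a Lie algebra isomorphism. -/
def IsLieIso {V₁ : Type} [AddCommGroup V₁] [Module ℝ V₁]
    {V₂ : Type} [AddCommGroup V₂] [Module ℝ V₂] {n₁ n₂ : ℕ}
    (br₁ : V₁ →ₗ[ℝ] V₁ →ₗ[ℝ] (Fin n₁ → ℝ))
    (br₂ : V₂ →ₗ[ℝ] V₂ →ₗ[ℝ] (Fin n₂ → ℝ))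
    (f : (V₁ × (Fin n₁ → ℝ)) ≃ₗ[ℝ] (V₂ × (Fin n₂ → ℝ))) : Prop :=
  ∀ x y : V₁ × (Fin n₁ → ℝ),
    f (0, br₁ x.1 y.1) = (0, br₂ (f x).1 (f y).1)

section Averaging

open scoped Matrix

variable {ι m m' : Type} [Fintype m] [DecidableEq m] [Fintype m'] [DecidableEq m']

/-- The matrices `M i` pairwise anticommute and square to the scalars `σ i = ±1`. -/
structure IsClifford (σ : ι → ℝ) (M : ι → Matrix m m ℝ) : Prop where
  sign : ∀ i, σ i = 1 ∨ σ i = -1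
  sq : ∀ i, M i * M i = σ i • (1 : Matrix m m ℝ)
  anti : ∀ i j, i ≠ j → M i * M j = -(M j * M i)

/-- A Clifford system consisting of orthogonal matrices. -/
structure IsOrthClifford (σ : ι → ℝ) (M : ι → Matrix m m ℝ) : Prop extends
    IsClifford σ M where
  transpose : ∀ i, (M i)ᵀ = σ i • M i

/-- The linear map `X ↦ A'ᵀ * X * A`. -/
def congrMap (A' : Matrix m' m' ℝ) (A : Matrix m m ℝ) :
    Matrix m' m ℝ →ₗ[ℝ] Matrix m' m ℝ where
  toFun X := A'ᵀ * X * A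
  map_add' X Y := by simp [Matrix.mul_add, Matrix.add_mul]
  map_smul' c X := by simp

/-- The composition of the maps `X ↦ X + τ • (M' a)ᵀ * X * M a` over the entries `a` of a list. -/
def avg (τ : ℝ) (M' : ι → Matrix m' m' ℝ) (M : ι → Matrix m m ℝ) :
    List ι → Matrix m' m ℝ →ₗ[ℝ] Matrix m' m ℝ
  | [] => LinearMap.id
  | a :: l => avg τ M' M l + τ • (congrMap (M' a) (M a) ∘ₗ avg τ M' M l)

/-- The product of the matrices `M a` over a list, in reverse order. -/
def listProd (M : ι → Matrix m m ℝ) : List ι → Matrix m m ℝ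
  | [] => 1
  | a :: l => listProd M l * M a

theorem avg_cons (τ : ℝ) (M' : ι → Matrix m' m' ℝ) (M : ι → Matrix m m ℝ) (a : ι) (l : List ι)
    (X : Matrix m' m ℝ) :
    avg τ M' M (a :: l) X = avg τ M' M l X + τ • ((M' a)ᵀ * avg τ M' M l X * M a) := rfl

theorem IsClifford.sign_sq {σ : ι → ℝ} {M : ι → Matrix m m ℝ} (h : IsClifford σ M) (i : ι) :
    σ i * σ i = 1 := by
  rcases h.sign i with h | h <;> rw [h] <;> norm_num

theorem IsOrthClifford.transpose_mul {σ : ι → ℝ} {M : ι → Matrix m m ℝ}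
    (h : IsOrthClifford σ M) (i : ι) : (M i)ᵀ * M i = 1 := by
  rw [h.transpose, Matrix.smul_mul, h.sq, smul_smul, h.sign_sq, one_smul]

theorem IsOrthClifford.mul_transpose {σ : ι → ℝ} {M : ι → Matrix m m ℝ}
    (h : IsOrthClifford σ M) (i : ι) : M i * (M i)ᵀ = 1 := by
  rw [h.transpose, Matrix.mul_smul, h.sq, smul_smul, h.sign_sq, one_smul]

theorem IsClifford.congr_congr {σ : ι → ℝ} {M' : ι → Matrix m' m' ℝ} {M : ι → Matrix m m ℝ}
    (h' : IsClifford σ M') (h : IsClifford σ M) (a : ι) (X : Matrix m' m ℝ) :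
    (M' a)ᵀ * ((M' a)ᵀ * X * M a) * M a = X := by
  calc _ = (M' a * M' a)ᵀ * X * (M a * M a) := by
        simp only [Matrix.transpose_mul, Matrix.mul_assoc]
    _ = X := by
        rw [h'.sq, h.sq]
        simp [smul_smul, h.sign_sq]

theorem IsClifford.congr_comm {σ : ι → ℝ} {M' : ι → Matrix m' m' ℝ} {M : ι → Matrix m m ℝ}
    (h' : IsClifford σ M') (h : IsClifford σ M) (a b : ι) (X : Matrix m' m ℝ) :
    (M' b)ᵀ * ((M' a)ᵀ * X * M a) * M b = (M' a)ᵀ * ((M' b)ᵀ * X * M b) * M a := by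
  rcases eq_or_ne a b with rfl | hab
  · rfl
  calc _ = (M' a * M' b)ᵀ * X * (M a * M b) := by
        simp only [Matrix.transpose_mul, Matrix.mul_assoc]
    _ = (M' b * M' a)ᵀ * X * (M b * M a) := by
        rw [h'.anti a b hab, h.anti a b hab]; simp
    _ = _ := by simp only [Matrix.transpose_mul, Matrix.mul_assoc]

theorem avg_invariant {σ : ι → ℝ} {τ : ℝ} (hτ : τ * τ = 1)
    {M' : ι → Matrix m' m' ℝ} {M : ι → Matrix m m ℝ}
    (h' : IsClifford σ M') (h : IsClifford σ M) (l : List ι) (X : Matrix m' m ℝ) :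
    ∀ b ∈ l, (M' b)ᵀ * avg τ M' M l X * M b = τ • avg τ M' M l X := by
  induction l with
  | nil => simp
  | cons a l ih =>
    intro b hb
    rw [avg_cons, Matrix.mul_add, Matrix.add_mul, Matrix.mul_smul, Matrix.smul_mul]
    by_cases hba : b = a
    · subst hba
      rw [h'.congr_congr h, smul_add, smul_smul, hτ, one_smul, add_comm]
    · have hb : b ∈ l := by simpa [hba] using hb
      rw [h'.congr_comm h, ih b hb]
      simp only [Matrix.mul_smul, Matrix.smul_mul, smul_add]

theorem avg_eq_self {τ : ℝ} (hτ : τ * τ = 1) {M' : ι → Matrix m' m' ℝ} {M : ι → Matrix m m ℝ}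
    {X : Matrix m' m ℝ} (hX : ∀ i, (M' i)ᵀ * X * M i = τ • X) (l : List ι) :
    avg τ M' M l X = (2 : ℝ) ^ l.length • X := by
  induction l with
  | nil => simp [avg]
  | cons a l ih =>
    rw [avg_cons, ih, Matrix.mul_smul, Matrix.smul_mul, hX, smul_smul, smul_smul, ← add_smul,
      List.length_cons]
    congr 1
    linear_combination (2 : ℝ) ^ l.length * hτ

theorem avg_transpose (τ : ℝ) (M : ι → Matrix m m ℝ) (l : List ι) (X : Matrix m m ℝ) :
    (avg τ M M l X)ᵀ = avg τ M M l Xᵀ := by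
  induction l with
  | nil => rfl
  | cons a l ih => simp [avg_cons, ih, Matrix.mul_assoc]

theorem posDef_avg (M : ι → Matrix m m ℝ) (l : List ι) : (avg 1 M M l 1).PosDef := by
  induction l with
  | nil => exact Matrix.PosDef.one
  | cons a l ih =>
    rw [avg_cons, one_smul]
    exact ih.add_posSemidef (by simpa using ih.posSemidef.conjTranspose_mul_mul_same (M a))

theorem avg_eq_sum (τ : ℝ) (M' : ι → Matrix m' m' ℝ) (M : ι → Matrix m m ℝ) (l : List ι)
    (X : Matrix m' m ℝ) :
    avg τ M' M l X =
      (l.sublists'.map fun s => τ ^ s.length • ((listProd M' s)ᵀ * X * listProd M s)).sum := by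
  induction l with
  | nil => simp [avg, listProd]
  | cons a l ih =>
    rw [avg_cons, ih, List.sublists'_cons, List.map_append, List.sum_append, List.map_map]
    congr 1
    change τ • congrMap (M' a) (M a) _ = _
    rw [map_list_sum, List.smul_sum, List.map_map, List.map_map]
    congr 2
    funext s
    simp [congrMap, listProd, pow_succ', smul_smul, Matrix.mul_assoc]

theorem sum_map_sublists_eq (f : List ι → ℝ) (l : List ι)
    (hf : ∀ s, s.Sublist l → s ≠ [] → f s = 0) : (l.sublists'.map f).sum = f [] := by
  induction l with
  | nil => simp
  | cons a l ih =>
    rw [List.sublists'_cons, List.map_append, List.sum_append,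
      ih fun s hs => hf s (hs.trans (List.sublist_cons_self a l)), List.map_map,
      List.sum_eq_zero, add_zero]
    intro x hx
    obtain ⟨s, hs, rfl⟩ := List.mem_map.1 hx
    exact hf _ ((List.mem_sublists'.1 hs).cons_cons a) (by simp)

theorem IsClifford.mul_listProd {σ : ι → ℝ} {M : ι → Matrix m m ℝ} (h : IsClifford σ M)
    {a : ι} {s : List ι} (ha : a ∉ s) :
    M a * listProd M s = (-1 : ℝ) ^ s.length • (listProd M s * M a) := by
  induction s with
  | nil => simp [listProd]
  | cons b s ih =>
    simp only [List.mem_cons, not_or] at ha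
    rw [listProd, ← Matrix.mul_assoc, ih ha.2, Matrix.smul_mul, Matrix.mul_assoc, h.anti a b ha.1,
      List.length_cons, pow_succ]
    simp [Matrix.mul_assoc]

theorem IsClifford.mul_listProd_of_mem {σ : ι → ℝ} {M : ι → Matrix m m ℝ} (h : IsClifford σ M)
    {a : ι} {s : List ι} (hs : s.Nodup) (ha : a ∈ s) :
    M a * listProd M s = (-1 : ℝ) ^ (s.length + 1) • (listProd M s * M a) := by
  induction s with
  | nil => simp at ha
  | cons b s ih =>
    rw [List.nodup_cons] at hs
    by_cases hab : a = b
    · subst hab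
      rw [listProd, ← Matrix.mul_assoc, h.mul_listProd hs.1, Matrix.smul_mul, List.length_cons,
        pow_add, pow_succ]
      simp
    · have ha : a ∈ s := by simpa [hab] using ha
      rw [listProd, ← Matrix.mul_assoc, ih hs.2 ha, Matrix.smul_mul, Matrix.mul_assoc,
        h.anti a b hab, List.length_cons, pow_succ _ (s.length + 1)]
      simp [Matrix.mul_assoc]

theorem IsClifford.listProd_mul_self {σ : ι → ℝ} {M : ι → Matrix m m ℝ} (h : IsClifford σ M)
    {s : List ι} (hs : s.Nodup) :
    listProd M s * listProd M s =
      ((-1 : ℝ) ^ (s.length * (s.length - 1) / 2) * (s.map σ).prod) • (1 : Matrix m m ℝ) := by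
  induction s with
  | nil => simp [listProd]
  | cons a s ih =>
    rw [List.nodup_cons] at hs
    have e : listProd M s * M a * (listProd M s * M a) =
        (-1 : ℝ) ^ s.length • (listProd M s * listProd M s * (M a * M a)) := by
      rw [Matrix.mul_assoc, ← Matrix.mul_assoc (M a), h.mul_listProd hs.1]
      simp [Matrix.mul_assoc]
    have hc : (s.length + 1) * (s.length + 1 - 1) / 2 =
        s.length + s.length * (s.length - 1) / 2 := by
      rw [← Finset.sum_range_id_mul_two, ← Finset.sum_range_id_mul_two, Finset.sum_range_succ,
        add_mul]
      omega
    rw [listProd, e, ih hs.2, h.sq, List.length_cons, List.map_cons, List.prod_cons, hc]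
    simp only [smul_smul, Matrix.smul_mul, Matrix.one_mul, pow_add]
    congr 1
    ring

theorem IsOrthClifford.listProd_transpose_mul {σ : ι → ℝ} {M : ι → Matrix m m ℝ}
    (h : IsOrthClifford σ M) (s : List ι) : (listProd M s)ᵀ * listProd M s = 1 := by
  induction s with
  | nil => simp [listProd]
  | cons a s ih =>
    rw [listProd, Matrix.transpose_mul, Matrix.mul_assoc, ← Matrix.mul_assoc _ (listProd M s), ih,
      Matrix.one_mul, h.transpose_mul]

end Averaging

section Counting

open scoped Matrix
open Complex (I)

variable {ι m m' : Type} [Fintype m] [DecidableEq m] [Fintype m'] [DecidableEq m']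

theorem trace_matrix_endomorphism (f : Matrix m m ℝ →ₗ[ℝ] Matrix m m ℝ) :
    LinearMap.trace ℝ _ f = ∑ a, ∑ b, f (Matrix.single a b 1) a b := by
  rw [LinearMap.trace_eq_matrix_trace ℝ (Matrix.stdBasis ℝ m m), Matrix.trace,
    Fintype.sum_prod_type]
  refine Finset.sum_congr rfl fun a _ => Finset.sum_congr rfl fun b _ => ?_
  rw [Matrix.diag_apply, LinearMap.toMatrix_apply, Matrix.stdBasis_eq_single]
  simp [Matrix.stdBasis]

theorem congr_single_apply (A' : Matrix m' m' ℝ) (A : Matrix m m ℝ) (a c : m') (b e : m) :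
    (A'ᵀ * Matrix.single a b (1 : ℝ) * A) c e = A' a c * A b e := by
  simp [Matrix.mul_apply, Matrix.single_apply, ite_and]

theorem re_one_sub_I_mul_I_pow (k : ℕ) :
    ((1 - I) * I ^ k).re = (-1 : ℝ) ^ (k * (k - 1) / 2) ∧
      ((1 - I) * I ^ k).im = -(-1 : ℝ) ^ ((k + 1) * k / 2) := by
  induction k with
  | zero => simp
  | succ k ih =>
    have e : (k + 1 + 1) * (k + 1) / 2 = k * (k - 1) / 2 + 2 * k + 1 := by
      rcases k with - | k
      · rfl
      · obtain ⟨c, hc⟩ := Nat.even_mul_succ_self k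
        rw [show (k + 1 + 1 + 1) * (k + 1 + 1) = 2 * (c + (2 * k + 3)) by linarith,
          show (k + 1) * (k + 1 - 1) = 2 * c by rw [Nat.add_sub_cancel]; linarith]
        omega
    rw [pow_succ, ← mul_assoc]
    constructor
    · rw [Complex.mul_re, ih.2]
      simp
    · rw [Complex.mul_im, ih.1, e, pow_add, pow_add, pow_mul]
      simp

theorem sum_sign_sublists (τ : ℝ) (σ : ι → ℝ) (l : List ι) :
    (l.sublists'.map fun s => τ ^ s.length *
      ((-1 : ℝ) ^ (s.length * (s.length - 1) / 2) * (s.map σ).prod)).sum =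
      ((1 - I) * (l.map fun a => 1 + I * ((τ * σ a : ℝ) : ℂ)).prod).re := by
  have key : (l.map fun a => 1 + I * ((τ * σ a : ℝ) : ℂ)).prod =
      (l.sublists'.map fun s => I ^ s.length * ((τ ^ s.length * (s.map σ).prod : ℝ) : ℂ)).sum := by
    induction l with
    | nil => simp
    | cons a l ih =>
      rw [List.map_cons, List.prod_cons, ih, List.sublists'_cons, List.map_append, List.sum_append,
        add_mul, one_mul, ← List.sum_map_mul_left, List.map_map]
      congr 3
      funext s
      simp only [Function.comp_apply, List.length_cons, List.map_cons, List.prod_cons]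
      push_cast
      ring
  have hre : ∀ L : List ℂ, L.sum.re = (L.map Complex.re).sum :=
    fun L => map_list_sum Complex.reAddGroupHom L
  rw [key, ← List.sum_map_mul_left, hre, List.map_map]
  congr 2
  funext s
  rw [Function.comp_apply, ← mul_assoc (1 - I), Complex.re_mul_ofReal,
    (re_one_sub_I_mul_I_pow _).1]
  ring

theorem IsOrthClifford.trace_listProd_eq_zero {σ : ι → ℝ} {M : ι → Matrix m m ℝ}
    (h : IsOrthClifford σ M) {l : List ι} (hl : l.Nodup)
    (hvol : Even l.length ∨ (-1 : ℝ) ^ (l.length * (l.length - 1) / 2) * (l.map σ).prod = -1)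
    {s : List ι} (hs : s.Sublist l) (hne : s ≠ []) : (listProd M s).trace = 0 := by
  have anti : ∀ a, M a * listProd M s = -(listProd M s * M a) → (listProd M s).trace = 0 := by
    intro a ha
    have : (listProd M s).trace = -(listProd M s).trace := by
      calc (listProd M s).trace = ((M a)ᵀ * (M a * listProd M s)).trace := by
            rw [← Matrix.mul_assoc, h.transpose_mul, Matrix.one_mul]
        _ = -(listProd M s).trace := by
            rw [ha, Matrix.mul_neg, Matrix.trace_neg, Matrix.trace_mul_comm, Matrix.mul_assoc,
              h.mul_transpose, Matrix.mul_one]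
    linarith
  rcases Nat.even_or_odd s.length with hev | hodd
  · obtain ⟨a, ha⟩ := List.exists_mem_of_ne_nil s hne
    refine anti a ?_
    rw [h.mul_listProd_of_mem (hl.sublist hs) ha, pow_succ, hev.neg_one_pow]
    simp
  · by_cases hex : ∃ a ∈ l, a ∉ s
    · obtain ⟨a, -, ha⟩ := hex
      refine anti a ?_
      rw [h.mul_listProd ha, hodd.neg_one_pow]
      simp
    · push Not at hex
      have hsl : s = l := hs.eq_of_length_le (List.subperm_of_subset hl hex).length_le
      subst hsl
      have hv := hvol.resolve_left (Nat.not_even_iff_odd.2 hodd)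
      have hsq := h.listProd_mul_self hl
      rw [hv, neg_one_smul] at hsq
      have ht : (listProd M s)ᵀ = -listProd M s := by
        have := congrArg (fun X => X * -listProd M s) (h.listProd_transpose_mul s)
        simpa [Matrix.mul_assoc, hsq] using this
      have := congrArg Matrix.trace ht
      rw [Matrix.trace_transpose, Matrix.trace_neg] at this
      linarith

/-- Symmetric matrices `X` with `(M i)ᵀ * X * M i = τ • X` for all `i`. -/
def invForms (τ : ℝ) (M : ι → Matrix m m ℝ) : Submodule ℝ (Matrix m m ℝ) where
  carrier := {X | Xᵀ = X ∧ ∀ i, (M i)ᵀ * X * M i = τ • X}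
  add_mem' {X Y} hX hY := by
    refine ⟨by rw [Matrix.transpose_add, hX.1, hY.1], fun i => ?_⟩
    rw [Matrix.mul_add, Matrix.add_mul, hX.2, hY.2, smul_add]
  zero_mem' := by simp
  smul_mem' c X hX := by
    refine ⟨by rw [Matrix.transpose_smul, hX.1], fun i => ?_⟩
    rw [Matrix.mul_smul, Matrix.smul_mul, hX.2, smul_comm]

theorem IsClifford.finrank_invForms {σ : ι → ℝ} {M : ι → Matrix m m ℝ} (h : IsClifford σ M)
    {τ : ℝ} (hτ : τ * τ = 1) {l : List ι} (hl : l.Nodup) (hmem : ∀ i, i ∈ l)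
    (htr : ∀ s, s.Sublist l → s ≠ [] → (listProd M s).trace = 0) :
    (Module.finrank ℝ (invForms τ M) : ℝ) * 2 ^ (l.length + 1) =
      (Fintype.card m : ℝ) ^ 2 + Fintype.card m *
        ((1 - I) * (l.map fun a => 1 + I * ((τ * σ a : ℝ) : ℂ)).prod).re := by
  let Ψ : Matrix m m ℝ →ₗ[ℝ] Matrix m m ℝ :=
    avg τ M M l + avg τ M M l ∘ₗ (Matrix.transposeLinearEquiv m m ℝ ℝ).toLinearMap
  have hΨ : ∀ X, Ψ X = avg τ M M l X + avg τ M M l Xᵀ := fun X => rfl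
  have hproj : LinearMap.IsProj (invForms τ M) (((2 : ℝ) ^ (l.length + 1))⁻¹ • Ψ) := by
    constructor
    · intro X
      rw [LinearMap.smul_apply]
      refine Submodule.smul_mem _ _ ⟨?_, fun i => ?_⟩
      · rw [hΨ, Matrix.transpose_add, avg_transpose, avg_transpose, Matrix.transpose_transpose,
          add_comm]
      · rw [hΨ, Matrix.mul_add, Matrix.add_mul, avg_invariant hτ h h _ _ i (hmem i),
          avg_invariant hτ h h _ _ i (hmem i), smul_add]
    · intro X hX
      rw [LinearMap.smul_apply, hΨ, hX.1, avg_eq_self hτ hX.2, ← add_smul, smul_smul]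
      rw [show ((2 : ℝ) ^ (l.length + 1))⁻¹ * (2 ^ l.length + 2 ^ l.length) = 1 by
        rw [pow_succ]; field_simp; norm_num, one_smul]
  have htrace := hproj.trace
  rw [map_smul, smul_eq_mul] at htrace
  have hΨtr : LinearMap.trace ℝ _ Ψ = (l.sublists'.map fun s =>
      τ ^ s.length * ((listProd M s).trace ^ 2 + (listProd M s * listProd M s).trace)).sum := by
    have hentry : ∀ a b, Ψ (Matrix.single a b 1) a b = (l.sublists'.map fun s => τ ^ s.length *
        (listProd M s a a * listProd M s b b + listProd M s b a * listProd M s a b)).sum := by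
      intro a b
      rw [hΨ, ← map_add, avg_eq_sum, Matrix.transpose_single]
      have he : ∀ X : Matrix m m ℝ, X a b = Matrix.entryLinearMap ℝ ℝ a b X := fun _ => rfl
      rw [he (List.sum _), map_list_sum, List.map_map]
      congr 2
      funext s
      simp [Matrix.mul_add, Matrix.add_mul, congr_single_apply]
      ring
    rw [trace_matrix_endomorphism]
    simp only [hentry]
    have hcomm : ∀ (L : List (List ι)) (f : List ι → m → m → ℝ),
        ∑ a, ∑ b, (L.map fun s => f s a b).sum = (L.map fun s => ∑ a, ∑ b, f s a b).sum := by
      intro L f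
      induction L with
      | nil => simp
      | cons s L ih => simp [Finset.sum_add_distrib, ih]
    rw [hcomm]
    congr 2
    funext s
    simp only [mul_add, Finset.sum_add_distrib]
    congr 1
    · simp only [pow_two, Matrix.trace, Matrix.diag_apply, Finset.sum_mul_sum]
      simp only [Finset.mul_sum]
    · simp only [Matrix.trace, Matrix.diag_apply, Matrix.mul_apply, Finset.mul_sum]
      exact Finset.sum_congr rfl fun a _ => Finset.sum_congr rfl fun b _ => by ring
  have hsplit : LinearMap.trace ℝ _ Ψ = (Fintype.card m : ℝ) ^ 2 + Fintype.card m *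
        ((1 - I) * (l.map fun a => 1 + I * ((τ * σ a : ℝ) : ℂ)).prod).re := by
    rw [hΨtr, ← sum_sign_sublists]
    simp only [mul_add]
    rw [List.sum_map_add, sum_map_sublists_eq _ l fun s hs hne => by rw [htr s hs hne]; simp,
      ← List.sum_map_mul_left]
    congr 1
    · simp [listProd]
    · congr 1
      refine List.map_congr_left fun s hs => ?_
      rw [h.listProd_mul_self (hl.sublist (List.mem_sublists'.1 hs)), Matrix.trace_smul,
        Matrix.trace_one, smul_eq_mul]
      ring
  rw [← hsplit, ← htrace]
  field_simp

theorem IsOrthClifford.exists_intertwiner [Nonempty m] [Nonempty m'] {σ : ι → ℝ}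
    {M' : ι → Matrix m' m' ℝ} {M : ι → Matrix m m ℝ}
    (h' : IsOrthClifford σ M') (h : IsOrthClifford σ M) {l : List ι} (hmem : ∀ i, i ∈ l)
    (htr : ∀ s, s.Sublist l → s ≠ [] → (listProd M s).trace = 0) :
    ∃ X : Matrix m' m ℝ, X ≠ 0 ∧ ∀ i, X * M i = M' i * X := by
  by_contra! hcon
  have hzero : ∀ X, avg 1 M' M l X = 0 := by
    intro X
    by_contra hX
    obtain ⟨i, hi⟩ := hcon _ hX
    refine hi ?_
    have := avg_invariant (one_mul 1) h'.toIsClifford h.toIsClifford l X i (hmem i)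
    rw [one_smul] at this
    conv_rhs => rw [← this]
    rw [Matrix.mul_assoc, ← Matrix.mul_assoc (M' i), h'.mul_transpose, Matrix.one_mul]
  have hsum : (l.sublists'.map fun s => (listProd M' s).trace * (listProd M s).trace).sum = 0 := by
    have hentry : ∀ a b, (l.sublists'.map fun s =>
        listProd M' s a a * listProd M s b b).sum = 0 := by
      intro a b
      have := congrArg (Matrix.entryLinearMap ℝ ℝ a b) (hzero (Matrix.single a b 1))
      rw [avg_eq_sum, map_list_sum, List.map_map] at this
      rw [← map_zero (Matrix.entryLinearMap ℝ ℝ a b), ← this]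
      congr 2
      funext s
      simp [congr_single_apply]
    have hcomm : ∀ L : List (List ι),
        ∑ a, ∑ b, (L.map fun s => listProd M' s a a * listProd M s b b).sum =
          (L.map fun s => (listProd M' s).trace * (listProd M s).trace).sum := by
      intro L
      induction L with
      | nil => simp
      | cons s L ih => simp [Finset.sum_add_distrib, ih, Matrix.trace, Finset.sum_mul_sum]
    rw [← hcomm]
    simp [hentry]
  rw [sum_map_sublists_eq _ l fun s hs hne => by rw [htr s hs hne, mul_zero]] at hsum
  simp [listProd] at hsum

end Counting

section Conversion

open scoped Matrix

variable {ι m : Type} [Fintype m] [DecidableEq m]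

/-- The square of the `i`-th generator of `Cl_{p,q}`. -/
def cliffSign (p q : ℕ) (i : Fin (p + q)) : ℝ := if (i : ℕ) < p then -1 else 1

/-- `S` is a nondegenerate symmetric form for which all `M i` are skew-adjoint. -/
structure IsSkewForm (S : Matrix m m ℝ) (M : ι → Matrix m m ℝ) : Prop where
  transpose : Sᵀ = S
  isUnit : IsUnit S
  skew : ∀ i, (M i)ᵀ * S = -(S * M i)

theorem sform_single_left (p q : ℕ) (i : Fin (p + q)) (W : Fin (p + q) → ℝ) :
    sform p q (Pi.single i 1) W = -cliffSign p q i * W i := by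
  unfold sform cliffSign
  rw [Finset.sum_eq_single i]
  · simp only [Pi.single_eq_same]
    split_ifs <;> ring
  · intro b _ hb
    simp [Pi.single_eq_of_ne hb]
  · simp

theorem cliffSign_sign (p q : ℕ) (i : Fin (p + q)) :
    cliffSign p q i = 1 ∨ cliffSign p q i = -1 := by
  unfold cliffSign
  split_ifs <;> simp

theorem Matrix.ext_dotProduct {m m' : Type} [Fintype m] [DecidableEq m] [Fintype m']
    [DecidableEq m'] {A A' : Matrix m m' ℝ}
    (h : ∀ x y, x ⬝ᵥ (A *ᵥ y) = x ⬝ᵥ (A' *ᵥ y)) : A = A' := by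
  ext i j
  simpa using h (Pi.single i 1) (Pi.single j 1)

theorem sform_add_left (p q : ℕ) (Z Z' W : Fin (p + q) → ℝ) :
    sform p q (Z + Z') W = sform p q Z W + sform p q Z' W := by
  simp only [sform, ← Finset.sum_add_distrib, Pi.add_apply]
  exact Finset.sum_congr rfl fun _ _ => by ring

theorem IsAdmissible.exists_matrix {p q : ℕ} {V : Type} [AddCommGroup V] [Module ℝ V]
    {B : V →ₗ[ℝ] V →ₗ[ℝ] ℝ} {J : (Fin (p + q) → ℝ) →ₗ[ℝ] V →ₗ[ℝ] V}
    (h : IsAdmissible p q V B J) :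
    ∃ (d : ℕ) (_ : 0 < d) (e : V ≃ₗ[ℝ] (Fin d → ℝ)) (M : Fin (p + q) → Matrix (Fin d) (Fin d) ℝ)
      (S : Matrix (Fin d) (Fin d) ℝ), IsOrthClifford (cliffSign p q) M ∧ IsSkewForm S M ∧
        (∀ i x, e (J (Pi.single i 1) x) = M i *ᵥ e x) ∧ ∀ x y, B x y = e x ⬝ᵥ (S *ᵥ e y) := by
  obtain ⟨hfd, hnt, hsymm, hnd, hJ, hskew⟩ := h
  let d := Module.finrank ℝ V
  let b := Module.finBasis ℝ V
  let N : Fin (p + q) → Matrix (Fin d) (Fin d) ℝ := fun i =>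
    LinearMap.toMatrix b b (J (Pi.single i 1))
  have hJJ : ∀ i j v, J (Pi.single i 1) (J (Pi.single j 1) v) +
      J (Pi.single j 1) (J (Pi.single i 1) v) =
        (-2 * sform p q (Pi.single i 1) (Pi.single j 1)) • v := by
    intro i j v
    have h1 := hJ (Pi.single i 1 + Pi.single j 1) v
    have h2 := hJ (Pi.single i 1) v
    have h3 := hJ (Pi.single j 1) v
    simp only [map_add, LinearMap.add_apply, sform_add_left] at h1
    have e1 : sform p q (Pi.single j 1) (Pi.single i 1) =
        sform p q (Pi.single i 1) (Pi.single j 1) := by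
      simp only [sform]
      exact Finset.sum_congr rfl fun _ _ => by ring
    simp only [sform_single_left, Pi.add_apply] at h1 h2 h3 e1 ⊢
    rw [h2, h3] at h1
    generalize J (Pi.single i 1) (J (Pi.single j 1) v) = a at *
    generalize J (Pi.single j 1) (J (Pi.single i 1) v) = c at *
    have : a + c = (-(-cliffSign p q i *
        ((Pi.single i 1 : Fin (p + q) → ℝ) i + (Pi.single j 1 : Fin (p + q) → ℝ) i) +
        -cliffSign p q j *
          ((Pi.single i 1 : Fin (p + q) → ℝ) j + (Pi.single j 1 : Fin (p + q) → ℝ) j))) • v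
        - (-(-cliffSign p q i * (Pi.single i 1 : Fin (p + q) → ℝ) i)) • v
        - (-(-cliffSign p q j * (Pi.single j 1 : Fin (p + q) → ℝ) j)) • v := by
      rw [← h1]; abel
    rw [this, ← sub_smul, ← sub_smul]
    congr 1
    linarith
  have hN : IsClifford (cliffSign p q) N := by
    refine ⟨cliffSign_sign p q, fun i => ?_, fun i j hij => ?_⟩
    · rw [← LinearMap.toMatrix_mul, ← LinearMap.toMatrix_one b, ← map_smul]
      congr 1
      ext v
      have := hJ (Pi.single i 1) v
      rw [sform_single_left] at this
      simpa using this
    · rw [← LinearMap.toMatrix_mul, ← LinearMap.toMatrix_mul, ← map_neg]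
      congr 1
      ext v
      have := hJJ i j v
      rw [sform_single_left, Pi.single_eq_of_ne hij, mul_zero, mul_zero, zero_smul] at this
      simpa using eq_neg_of_add_eq_zero_left this
  have hG := posDef_avg N (List.finRange (p + q))
  have hGinv : ∀ i, (N i)ᵀ * avg 1 N N (List.finRange (p + q)) 1 * N i =
      avg 1 N N (List.finRange (p + q)) 1 := fun i => by
    simpa using avg_invariant (one_mul 1) hN hN (List.finRange (p + q)) 1 i (List.mem_finRange i)
  generalize avg 1 N N (List.finRange (p + q)) 1 = G at hG hGinv
  obtain ⟨Q, hQ, hQG⟩ : ∃ Q : Matrix (Fin d) (Fin d) ℝ, IsUnit Q ∧ G = Qᵀ * Q := by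
    open scoped MatrixOrder ComplexOrder in
    obtain ⟨Q, hQ⟩ := CStarAlgebra.nonneg_iff_eq_star_mul_self.1 hG.posSemidef.nonneg
    have hQ' : G = Qᵀ * Q := by
      rw [hQ, Matrix.star_eq_conjTranspose, Matrix.conjTranspose_eq_transpose_of_trivial]
    refine ⟨Q, ?_, hQ'⟩
    have := hG.isUnit
    rw [Matrix.isUnit_iff_isUnit_det] at this ⊢
    rw [hQ', Matrix.det_mul] at this
    exact isUnit_of_mul_isUnit_right this
  have hdet := (Matrix.isUnit_iff_isUnit_det Q).1 hQ
  have hl : Q⁻¹ * Q = 1 := Matrix.nonsing_inv_mul Q hdet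
  have hr : Q * Q⁻¹ = 1 := Matrix.mul_nonsing_inv Q hdet
  have hconj : ∀ A C : Matrix (Fin d) (Fin d) ℝ,
      Q * A * Q⁻¹ * (Q * C * Q⁻¹) = Q * (A * C) * Q⁻¹ := by
    intro A C
    simp only [Matrix.mul_assoc]
    rw [← Matrix.mul_assoc Q⁻¹ Q, hl, Matrix.one_mul]
  let e : V ≃ₗ[ℝ] (Fin d → ℝ) := b.equivFun.trans
    (Matrix.toLinearEquiv' Q (Matrix.invertibleOfIsUnitDet Q hdet))
  have he : ∀ x, e x = Q *ᵥ b.equivFun x := fun x => rfl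
  let β : (Fin d → ℝ) →ₗ[ℝ] (Fin d → ℝ) →ₗ[ℝ] ℝ := B.compl₁₂ e.symm.toLinearMap e.symm.toLinearMap
  let S : Matrix (Fin d) (Fin d) ℝ := LinearMap.toMatrix₂' ℝ β
  have hS : ∀ x y, β x y = x ⬝ᵥ (S *ᵥ y) := by
    intro x y
    rw [← Matrix.toLinearMap₂'_apply']
    simp [S]
  have hB : ∀ x y, B x y = e x ⬝ᵥ (S *ᵥ e y) := by
    intro x y
    rw [← hS]
    simp [β]
  have hM : ∀ i x, e (J (Pi.single i 1) x) = (Q * N i * Q⁻¹) *ᵥ e x := by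
    intro i x
    rw [he, he, Matrix.mulVec_mulVec, Matrix.mul_assoc, hl, Matrix.mul_one, ← Matrix.mulVec_mulVec]
    congr 1
    exact (LinearMap.toMatrix_mulVec_repr b b _ x).symm
  refine ⟨d, Module.finrank_pos, e, fun i => Q * N i * Q⁻¹, S, ?_, ?_, hM, hB⟩
  · refine ⟨⟨hN.sign, fun i => ?_, fun i j hij => ?_⟩, fun i => ?_⟩
    · simp only [hconj, hN.sq, Matrix.mul_smul, Matrix.smul_mul, Matrix.mul_one, hr]
    · simp only [hconj, hN.anti i j hij, Matrix.mul_neg, Matrix.neg_mul]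
    · have hGN : (N i)ᵀ * G = cliffSign p q i • (G * N i) := by
        calc (N i)ᵀ * G = cliffSign p q i • ((N i)ᵀ * G * (N i * N i)) := by
              rw [hN.sq, Matrix.mul_smul, smul_smul, hN.sign_sq, one_smul, Matrix.mul_one]
          _ = _ := by rw [← Matrix.mul_assoc, hGinv]
      have hQ1 : Q⁻¹ᵀ * G = Q := by
        rw [hQG, ← Matrix.mul_assoc, ← Matrix.transpose_mul, hr, Matrix.transpose_one,
          Matrix.one_mul]
      have hQ2 : Qᵀ = G * Q⁻¹ := by rw [hQG, Matrix.mul_assoc, hr, Matrix.mul_one]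
      rw [Matrix.transpose_mul, Matrix.transpose_mul, hQ2, ← Matrix.mul_assoc (N i)ᵀ, hGN,
        Matrix.smul_mul, Matrix.mul_smul, Matrix.mul_assoc G, ← Matrix.mul_assoc Q⁻¹ᵀ, hQ1,
        Matrix.mul_assoc]
  · refine ⟨?_, ?_, fun i => ?_⟩
    · refine Matrix.ext_dotProduct fun x y => ?_
      rw [← hS, Matrix.mulVec_transpose, dotProduct_comm, ← Matrix.dotProduct_mulVec, ← hS]
      exact hsymm _ _
    · rw [← Matrix.mulVec_injective_iff_isUnit]
      intro x y hxy
      rw [← sub_eq_zero, ← e.symm.map_eq_zero_iff]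
      refine hnd _ fun w => ?_
      rw [hsymm, hB, e.apply_symm_apply, Matrix.mulVec_sub, hxy, sub_self, dotProduct_zero]
    · refine Matrix.ext_dotProduct fun x y => ?_
      have := hskew (Pi.single i 1) (e.symm x) (e.symm y)
      simp only [hB, hM, e.apply_symm_apply] at this
      rw [← Matrix.mulVec_mulVec, Matrix.neg_mulVec, dotProduct_neg, ← Matrix.mulVec_mulVec, ← this,
        Matrix.mulVec_transpose, dotProduct_comm, ← Matrix.dotProduct_mulVec, dotProduct_comm]

theorem IsClifford.sum_smul_mul_self [Fintype ι] {σ : ι → ℝ} {M : ι → Matrix m m ℝ}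
    (h : IsClifford σ M) (Z : ι → ℝ) :
    (∑ i, Z i • M i) * (∑ i, Z i • M i) = (∑ i, σ i * Z i * Z i) • (1 : Matrix m m ℝ) := by
  classical
  have hij : ∀ i j, (Z i • M i) * (Z j • M j) + (Z j • M j) * (Z i • M i) =
      (2 : ℝ) • if i = j then (σ i * Z i * Z i) • (1 : Matrix m m ℝ) else 0 := by
    intro i j
    split_ifs with hc
    · subst hc
      simp only [Matrix.mul_smul, Matrix.smul_mul, h.sq, smul_smul, ← add_smul]
      congr 1
      ring
    · simp only [Matrix.mul_smul, Matrix.smul_mul, h.anti i j hc, smul_smul, smul_neg, smul_zero,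
        mul_comm (Z j)]
      simp
  have h2 : (2 : ℝ) • ((∑ i, Z i • M i) * (∑ i, Z i • M i)) =
      (2 : ℝ) • ((∑ i, σ i * Z i * Z i) • (1 : Matrix m m ℝ)) := by
    rw [two_smul]
    conv_lhs => rw [Finset.sum_mul_sum]
    conv_lhs => enter [2]; rw [Finset.sum_comm]
    simp only [← Finset.sum_add_distrib, hij]
    simp only [← Finset.smul_sum, Finset.sum_ite_eq, Finset.mem_univ, if_true, Finset.sum_smul]
  exact smul_right_injective _ two_ne_zero h2

theorem IsSkewForm.exists_isAdmissible {p q : ℕ} {M : Fin (p + q) → Matrix m m ℝ}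
    {S : Matrix m m ℝ} (hS : IsSkewForm S M) (h : IsClifford (cliffSign p q) M)
    {U : Submodule ℝ (m → ℝ)} (hU : U ≠ ⊥) (hUM : ∀ i, ∀ x ∈ U, M i *ᵥ x ∈ U)
    (hUS : ∀ x ∈ U, S *ᵥ x ∈ U) :
    ∃ (B : U →ₗ[ℝ] U →ₗ[ℝ] ℝ) (J : (Fin (p + q) → ℝ) →ₗ[ℝ] U →ₗ[ℝ] U), IsAdmissible p q U B J := by
  let β : U →ₗ[ℝ] U →ₗ[ℝ] ℝ := (Matrix.toLinearMap₂' ℝ S).compl₁₂ U.subtype U.subtype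
  let J : (Fin (p + q) → ℝ) →ₗ[ℝ] U →ₗ[ℝ] U :=
    Fintype.linearCombination ℝ fun i => (Matrix.toLin' (M i)).restrict (hUM i)
  have hβ : ∀ x y : U, β x y = (x : m → ℝ) ⬝ᵥ (S *ᵥ (y : m → ℝ)) := fun x y => by
    rw [← Matrix.toLinearMap₂'_apply']; rfl
  have hJ : ∀ Z (x : U), (J Z x : m → ℝ) = (∑ i, Z i • M i) *ᵥ (x : m → ℝ) := fun Z x => by
    simp [J, Fintype.linearCombination_apply, Matrix.sum_mulVec, Matrix.smul_mulVec]
    rfl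
  refine ⟨β, J, inferInstance, (Submodule.nontrivial_iff_ne_bot).2 hU, fun v w => ?_,
    fun v hv => ?_, fun Z v => ?_, fun Z v w => ?_⟩
  · rw [hβ, hβ, Matrix.dotProduct_mulVec, ← Matrix.mulVec_transpose, hS.transpose, dotProduct_comm]
  · have h0 := hv ⟨S *ᵥ v, hUS v v.2⟩
    rw [hβ, Matrix.dotProduct_mulVec, ← Matrix.mulVec_transpose, hS.transpose,
      dotProduct_self_eq_zero] at h0
    have hinj := Matrix.mulVec_injective_iff_isUnit.2 hS.isUnit
    exact Subtype.ext (hinj (h0.trans (Matrix.mulVec_zero S).symm))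
  · refine Subtype.ext ?_
    rw [hJ, hJ, Matrix.mulVec_mulVec, h.sum_smul_mul_self, Matrix.smul_mulVec, Matrix.one_mulVec,
      Submodule.coe_smul]
    congr 1
    simp only [sform, cliffSign, ← Finset.sum_neg_distrib]
    refine Finset.sum_congr rfl fun i _ => ?_
    split_ifs <;> ring
  · rw [hβ, hβ, hJ, hJ, Matrix.mulVec_mulVec, ← dotProduct_neg, ← Matrix.neg_mulVec, Matrix.mul_sum]
    rw [Matrix.dotProduct_mulVec, ← Matrix.mulVec_transpose, hS.transpose, Matrix.mulVec_mulVec,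
      dotProduct_comm, Matrix.dotProduct_mulVec, ← Matrix.mulVec_transpose, dotProduct_comm,
      Matrix.transpose_mul, hS.transpose, Matrix.transpose_sum, Matrix.sum_mul]
    congr 2
    rw [← Finset.sum_neg_distrib]
    refine Finset.sum_congr rfl fun i _ => ?_
    rw [Matrix.transpose_smul, Matrix.smul_mul, hS.skew, Matrix.mul_smul, smul_neg]

end Conversion

section Structure

open scoped Matrix

variable {ι m : Type} [Fintype m] [DecidableEq m]

/-- The family `M` has no nontrivial common invariant subspace. -/
def IsIrred (M : ι → Matrix m m ℝ) : Prop :=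
  ∀ U : Submodule ℝ (m → ℝ), (∀ i, ∀ x ∈ U, M i *ᵥ x ∈ U) → U = ⊥ ∨ U = ⊤

theorem IsIrred.exists_eq_smul_one [Nonempty m] {M : ι → Matrix m m ℝ} (hirr : IsIrred M)
    {X : Matrix m m ℝ} (hX : Xᵀ = X) (hc : ∀ i, X * M i = M i * X) :
    ∃ c : ℝ, X = c • (1 : Matrix m m ℝ) := by
  have hH : X.IsHermitian := by
    rw [Matrix.IsHermitian, Matrix.conjTranspose_eq_transpose_of_trivial, hX]
  obtain ⟨k⟩ := ‹Nonempty m›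
  let c := hH.eigenvalues k
  let v : m → ℝ := (hH.eigenvectorBasis k).ofLp
  have hv : X *ᵥ v = c • v := hH.mulVec_eigenvectorBasis k
  have hv0 : v ≠ 0 := by
    intro h0
    apply hH.eigenvectorBasis.orthonormal.ne_zero k
    ext i
    exact congrFun h0 i
  rcases hirr (LinearMap.ker (X - c • (1 : Matrix m m ℝ)).mulVecLin) (fun i x hx => by
    rw [LinearMap.mem_ker, Matrix.mulVecLin_apply] at hx ⊢
    rw [Matrix.mulVec_mulVec, Matrix.sub_mul, hc, Matrix.smul_mul, Matrix.one_mul]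
    have : M i * X - c • M i = M i * (X - c • (1 : Matrix m m ℝ)) := by
      rw [Matrix.mul_sub, Matrix.mul_smul, Matrix.mul_one]
    rw [this, ← Matrix.mulVec_mulVec, hx, Matrix.mulVec_zero]) with hb | ht
  · refine absurd ?_ hv0
    rw [← Submodule.mem_bot ℝ, ← hb, LinearMap.mem_ker, Matrix.mulVecLin_apply, Matrix.sub_mulVec,
      hv, Matrix.smul_mulVec, Matrix.one_mulVec, sub_self]
  · refine ⟨c, ?_⟩
    rw [LinearMap.ker_eq_top] at ht
    rw [← sub_eq_zero, ← Matrix.toLin'.map_eq_zero_iff]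
    exact ht

theorem IsSkewForm.mul_eq {σ : ι → ℝ} {M : ι → Matrix m m ℝ} {S : Matrix m m ℝ}
    (hS : IsSkewForm S M) (h : IsOrthClifford σ M) (i : ι) : S * M i = -(σ i • (M i * S)) := by
  rw [← Matrix.smul_mul, ← h.transpose, hS.skew, neg_neg]

theorem IsSkewForm.mul_listProd {σ : ι → ℝ} {M : ι → Matrix m m ℝ} {S : Matrix m m ℝ}
    (hS : IsSkewForm S M) (h : IsOrthClifford σ M) (s : List ι) :
    S * listProd M s = (s.map fun i => -σ i).prod • (listProd M s * S) := by
  induction s with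
  | nil => simp [listProd]
  | cons a s ih =>
    rw [listProd, ← Matrix.mul_assoc, ih, Matrix.smul_mul, Matrix.mul_assoc, hS.mul_eq h,
      List.map_cons, List.prod_cons, Matrix.mul_neg, Matrix.mul_smul, ← neg_smul, smul_smul,
      mul_comm, Matrix.mul_assoc]

theorem mul_listProd_of_anti {M : ι → Matrix m m ℝ} {T : Matrix m m ℝ}
    (hT : ∀ i, T * M i = -(M i * T)) (s : List ι) :
    T * listProd M s = (-1 : ℝ) ^ s.length • (listProd M s * T) := by
  induction s with
  | nil => simp [listProd]
  | cons a s ih =>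
    rw [listProd, ← Matrix.mul_assoc, ih, Matrix.smul_mul, Matrix.mul_assoc, hT,
      List.length_cons, pow_succ, mul_neg_one, neg_smul, Matrix.mul_neg, smul_neg, Matrix.mul_assoc]

theorem IsOrthClifford.quad {σ : ι → ℝ} {M : ι → Matrix m m ℝ} (h : IsOrthClifford σ M)
    {s : List ι} (hs : s.Nodup) (hlen : s.length = 4) (hσ : (s.map σ).prod = 1) :
    listProd M s * listProd M s = 1 ∧ (listProd M s)ᵀ = listProd M s := by
  have h1 : listProd M s * listProd M s = 1 := by
    rw [h.listProd_mul_self hs, hlen, hσ]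
    norm_num
  refine ⟨h1, ?_⟩
  calc (listProd M s)ᵀ = (listProd M s)ᵀ * listProd M s * listProd M s := by
        rw [Matrix.mul_assoc, h1, Matrix.mul_one]
    _ = listProd M s := by rw [h.listProd_transpose_mul, Matrix.one_mul]

theorem listProd_mulVec_mem {M : ι → Matrix m m ℝ} {U : Submodule ℝ (m → ℝ)}
    (hU : ∀ i, ∀ x ∈ U, M i *ᵥ x ∈ U) (s : List ι) : ∀ x ∈ U, listProd M s *ᵥ x ∈ U := by
  induction s with
  | nil => simp [listProd]
  | cons a s ih =>
    intro x hx
    rw [listProd, ← Matrix.mulVec_mulVec]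
    exact ih _ (hU a x hx)

theorem IsOrthClifford.exists_skewForm {q : ℕ} {M : Fin (q + 4) → Matrix m m ℝ}
    (h : IsOrthClifford (cliffSign q 4) M) :
    ∃ P : Matrix m m ℝ, P * P = 1 ∧ IsSkewForm P M ∧
      (∀ S : Matrix m m ℝ, IsSkewForm S M → S * P = P * S) ∧
      (∀ T : Matrix m m ℝ, (∀ i, T * M i = -(M i * T)) → T * P = P * T) ∧
      ∀ U : Submodule ℝ (m → ℝ), (∀ i, ∀ x ∈ U, M i *ᵥ x ∈ U) → ∀ x ∈ U, P *ᵥ x ∈ U := by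
  let s : List (Fin (q + 4)) := (List.finRange 4).map (Fin.natAdd q)
  have hs : s.Nodup := (List.nodup_finRange 4).map (Fin.natAdd_injective 4 q)
  have hlen : s.length = 4 := by simp [s]
  have hmem : ∀ i, i ∈ s ↔ q ≤ (i : ℕ) := by
    intro i
    simp only [s, List.mem_map, List.mem_finRange, true_and]
    refine ⟨?_, fun hi => ⟨⟨i - q, by omega⟩, by ext; simp; omega⟩⟩
    rintro ⟨j, rfl⟩
    simp
  have hpos : ∀ i ∈ s, cliffSign q 4 i = 1 := fun i hi => by
    rw [hmem] at hi
    simp [cliffSign, hi]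
  have hσ : (s.map (cliffSign q 4)).prod = 1 := by
    rw [List.map_congr_left hpos, List.map_const', List.prod_replicate, hlen]
    norm_num
  obtain ⟨h1, h2⟩ := h.quad hs hlen hσ
  refine ⟨listProd M s, h1, ⟨h2, IsUnit.of_mul_eq_one _ h1, fun i => ?_⟩,
    fun S hS => ?_, fun T hT => ?_, fun U hU => listProd_mulVec_mem hU s⟩
  case refine_3 =>
    rw [mul_listProd_of_anti hT, hlen]
    norm_num
  case refine_2 =>
    rw [hS.mul_listProd h, List.map_congr_left fun i hi => by rw [hpos i hi], List.map_const',
      List.prod_replicate, hlen]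
    norm_num
  rw [h.transpose, Matrix.smul_mul]
  by_cases hi : q ≤ (i : ℕ)
  · rw [h.mul_listProd_of_mem hs ((hmem i).2 hi), hlen]
    norm_num [cliffSign, hi]
  · rw [h.mul_listProd (mt (hmem i).1 hi), hlen]
    push Not at hi
    norm_num [cliffSign, hi]

theorem IsSkewForm.exists_grading {q : ℕ} {M : Fin (4 + q) → Matrix m m ℝ} {S : Matrix m m ℝ}
    (hS : IsSkewForm S M) (h : IsOrthClifford (cliffSign 4 q) M) :
    ∃ P : Matrix m m ℝ, P * P = 1 ∧ Pᵀ = P ∧ S * P = P * S ∧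
      ∀ i, P * M i = cliffSign 4 q i • (M i * P) := by
  let s : List (Fin (4 + q)) := (List.finRange 4).map (Fin.castAdd q)
  have hs : s.Nodup := (List.nodup_finRange 4).map (Fin.castAdd_injective 4 q)
  have hlen : s.length = 4 := by simp [s]
  have hmem : ∀ i, i ∈ s ↔ (i : ℕ) < 4 := by
    intro i
    simp only [s, List.mem_map, List.mem_finRange, true_and]
    refine ⟨?_, fun hi => ⟨⟨i, hi⟩, rfl⟩⟩
    rintro ⟨j, rfl⟩
    simp
  have hneg : ∀ i ∈ s, cliffSign 4 q i = -1 := fun i hi => by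
    rw [hmem] at hi
    simp [cliffSign, hi]
  have hσ : (s.map (cliffSign 4 q)).prod = 1 := by
    rw [List.map_congr_left hneg, List.map_const', List.prod_replicate, hlen]
    norm_num
  obtain ⟨h1, h2⟩ := h.quad hs hlen hσ
  have hcomm : S * listProd M s = listProd M s * S := by
    rw [hS.mul_listProd h, List.map_congr_left fun i hi => by rw [hneg i hi], List.map_const',
      List.prod_replicate, hlen]
    norm_num
  refine ⟨listProd M s, h1, h2, hcomm, fun i => ?_⟩
  by_cases hi : (i : ℕ) < 4
  · rw [h.mul_listProd_of_mem hs ((hmem i).2 hi), hlen]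
    norm_num [cliffSign, hi]
  · rw [h.mul_listProd (mt (hmem i).1 hi), hlen]
    norm_num [cliffSign, hi]

theorem IsSkewForm.isIrred_of_minimal {p q d : ℕ} {M : Fin (p + q) → Matrix (Fin d) (Fin d) ℝ}
    {S : Matrix (Fin d) (Fin d) ℝ} (hS : IsSkewForm S M) (h : IsOrthClifford (cliffSign p q) M)
    (hmin : ∀ (V' : Type) [AddCommGroup V'] [Module ℝ V'] (B' : V' →ₗ[ℝ] V' →ₗ[ℝ] ℝ)
      (J' : (Fin (p + q) → ℝ) →ₗ[ℝ] V' →ₗ[ℝ] V'),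
      IsAdmissible p q V' B' J' → d ≤ Module.finrank ℝ V') :
    IsIrred fun o : Option (Fin (p + q)) => o.elim S M := by
  intro U hU
  by_cases hb : U = ⊥
  · exact Or.inl hb
  · obtain ⟨B, J, hBJ⟩ := hS.exists_isAdmissible h.toIsClifford hb (fun i => hU (some i)) (hU none)
    right
    refine Submodule.eq_top_of_finrank_eq (le_antisymm (Submodule.finrank_le U) ?_)
    rw [Module.finrank_fin_fun]
    exact hmin U B J hBJ

theorem IsOrthClifford.isIrred_of_minimal {q d : ℕ} {M : Fin (q + 4) → Matrix (Fin d) (Fin d) ℝ}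
    (h : IsOrthClifford (cliffSign q 4) M)
    (hmin : ∀ (V' : Type) [AddCommGroup V'] [Module ℝ V'] (B' : V' →ₗ[ℝ] V' →ₗ[ℝ] ℝ)
      (J' : (Fin (q + 4) → ℝ) →ₗ[ℝ] V' →ₗ[ℝ] V'),
      IsAdmissible q 4 V' B' J' → d ≤ Module.finrank ℝ V') :
    IsIrred M := by
  obtain ⟨P, -, hP, -, -, hPU⟩ := h.exists_skewForm
  exact fun U hU => hP.isIrred_of_minimal h hmin U fun o =>
    o.rec (hPU U hU) fun i => hU i

theorem IsSkewForm.finrank_le {p q d k : ℕ} (hd : 0 < d)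
    {M : Fin (p + q) → Matrix (Fin d) (Fin d) ℝ}
    {S : Matrix (Fin d) (Fin d) ℝ} (hS : IsSkewForm S M) (h : IsOrthClifford (cliffSign p q) M)
    (hmin : ∀ (V' : Type) [AddCommGroup V'] [Module ℝ V'] (B' : V' →ₗ[ℝ] V' →ₗ[ℝ] ℝ)
      (J' : (Fin (p + q) → ℝ) →ₗ[ℝ] V' →ₗ[ℝ] V'),
      IsAdmissible p q V' B' J' → k ≤ Module.finrank ℝ V') : k ≤ d := by
  have : Nonempty (Fin d) := ⟨⟨0, hd⟩⟩
  obtain ⟨B, J, hBJ⟩ := hS.exists_isAdmissible h.toIsClifford (U := ⊤) top_ne_bot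
    (by simp) (by simp)
  simpa using hmin _ B J hBJ

/-- Invariant forms of an irreducible `Cl_{q,4}`-module are unique up to scale, and commute with
all matrices anticommuting with the generators. -/
theorem IsSkewForm.smul_and_commute [Nonempty m] {q : ℕ} {M : Fin (q + 4) → Matrix m m ℝ}
    {S S' : Matrix m m ℝ} (hS : IsSkewForm S M) (hS' : IsSkewForm S' M)
    (h : IsOrthClifford (cliffSign q 4) M) (hirr : IsIrred M) :
    (∃ c : ℝ, c ≠ 0 ∧ S' = c • S) ∧
      ∀ T : Matrix m m ℝ, (∀ i, T * M i = -(M i * T)) → S * T = T * S := by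
  obtain ⟨P, hPP, hP, hPS, hPT, -⟩ := h.exists_skewForm
  have key : ∀ S : Matrix m m ℝ, IsSkewForm S M → ∃ c : ℝ, c ≠ 0 ∧ S = c • P := by
    intro S hS
    have hc : ∀ i, (S * P) * M i = M i * (S * P) := fun i => by
      rw [Matrix.mul_assoc, hP.mul_eq h, Matrix.mul_neg, Matrix.mul_smul, ← Matrix.mul_assoc,
        hS.mul_eq h, Matrix.neg_mul, Matrix.smul_mul, smul_neg, neg_neg, smul_smul, h.sign_sq,
        one_smul, Matrix.mul_assoc]
    obtain ⟨c, hc⟩ := hirr.exists_eq_smul_one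
      (by rw [Matrix.transpose_mul, hS.transpose, hP.transpose, hPS S hS]) hc
    have hcP : S = c • P := by
      rw [← Matrix.mul_one S, ← hPP, ← Matrix.mul_assoc, hc, Matrix.smul_mul, Matrix.one_mul]
    refine ⟨c, ?_, hcP⟩
    rintro rfl
    exact not_isUnit_zero ((zero_smul ℝ P ▸ hcP) ▸ hS.isUnit)
  obtain ⟨c, hc, hcS⟩ := key S hS
  obtain ⟨c', hc', hcS'⟩ := key S' hS'
  refine ⟨⟨c' / c, div_ne_zero hc' hc, ?_⟩, fun T hT => ?_⟩
  · rw [hcS, hcS', smul_smul, div_mul_cancel₀ _ hc]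
  · rw [hcS, Matrix.smul_mul, Matrix.mul_smul, hPT T hT]

theorem pos_of_mul_self_eq_smul {X : Matrix m m ℝ} (hX : Xᵀ = X) (h0 : X ≠ 0) {c : ℝ}
    (hc : X * X = c • (1 : Matrix m m ℝ)) : 0 < c := by
  obtain ⟨k, j, hkj⟩ : ∃ k j, X k j ≠ 0 := by
    by_contra! hcon
    exact h0 (Matrix.ext hcon)
  have hk : (X * X) k k = c := by simp [hc]
  rw [Matrix.mul_apply, Finset.sum_congr rfl fun j _ => by
    rw [show X j k = X k j from congrFun (congrFun hX k) j]] at hk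
  rw [← hk]
  exact Finset.sum_pos' (fun j _ => mul_self_nonneg _) ⟨j, Finset.mem_univ j, mul_self_pos.2 hkj⟩

/-- For a `Cl_{4,q}`-module with no invariant nondegenerate proper submodule there is an orthogonal
involution anticommuting with the generators. -/
theorem IsSkewForm.exists_involution [Nonempty m] {q : ℕ} {M : Fin (4 + q) → Matrix m m ℝ}
    {S : Matrix m m ℝ} (hS : IsSkewForm S M) (h : IsOrthClifford (cliffSign 4 q) M)
    (hirr : IsIrred fun o : Option (Fin (4 + q)) => o.elim S M) :
    ∃ T : Matrix m m ℝ, Tᵀ = T ∧ T * T = 1 ∧ (∀ i, T * M i = -(M i * T)) ∧ S * T = T * S := by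
  obtain ⟨P, hPP, hPt, hSP, hPM⟩ := hS.exists_grading h
  have hSS : ∀ i, S * S * M i = M i * (S * S) := fun i => by
    rw [Matrix.mul_assoc, hS.mul_eq h, Matrix.mul_neg, Matrix.mul_smul, ← Matrix.mul_assoc,
      hS.mul_eq h, Matrix.neg_mul, Matrix.smul_mul, smul_neg, neg_neg, smul_smul, h.sign_sq,
      one_smul, Matrix.mul_assoc]
  obtain ⟨c, hc⟩ := hirr.exists_eq_smul_one (X := S * S)
    (by rw [Matrix.transpose_mul, hS.transpose]) fun o =>
      o.rec (Matrix.mul_assoc _ _ _) hSS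
  have hcpos := pos_of_mul_self_eq_smul hS.transpose hS.isUnit.ne_zero hc
  have hsq : (√c)⁻¹ * (√c)⁻¹ * c = 1 := by
    rw [← mul_inv, Real.mul_self_sqrt hcpos.le, inv_mul_cancel₀ hcpos.ne']
  refine ⟨(√c)⁻¹ • (S * P), ?_, ?_, fun i => ?_, ?_⟩
  · rw [Matrix.transpose_smul, Matrix.transpose_mul, hPt, hS.transpose, hSP]
  · rw [Matrix.smul_mul, Matrix.mul_smul, smul_smul]
    nth_rw 2 [hSP]
    rw [Matrix.mul_assoc, ← Matrix.mul_assoc P, hPP, Matrix.one_mul, hc, smul_smul, hsq, one_smul]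
  · rw [Matrix.smul_mul, Matrix.mul_smul, ← smul_neg]
    congr 1
    rw [Matrix.mul_assoc, hPM, Matrix.mul_smul, ← Matrix.mul_assoc, hS.mul_eq h, Matrix.neg_mul,
      Matrix.smul_mul, smul_neg, smul_smul, h.sign_sq, one_smul, Matrix.mul_assoc]
  · rw [Matrix.smul_mul, Matrix.mul_smul, Matrix.mul_assoc, hSP]

theorem cliffSign_finAddFlip (p q : ℕ) (i : Fin (q + p)) :
    cliffSign p q (finAddFlip i) = -cliffSign q p i := by
  refine Fin.addCases (fun j => ?_) (fun j => ?_) i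
  · simp [cliffSign, finAddFlip_apply_castAdd]
  · simp [cliffSign, finAddFlip_apply_natAdd]

theorem IsOrthClifford.swap {p q : ℕ} {M : Fin (p + q) → Matrix m m ℝ}
    (h : IsOrthClifford (cliffSign p q) M) {T : Matrix m m ℝ} (hT : Tᵀ = T) (hTT : T * T = 1)
    (hTM : ∀ i, T * M i = -(M i * T)) :
    IsOrthClifford (cliffSign q p) fun i => T * M (finAddFlip i) := by
  have hmul : ∀ i j, T * M i * (T * M j) = -(M i * M j) := fun i j => by
    rw [hTM i, Matrix.neg_mul, Matrix.mul_assoc, ← Matrix.mul_assoc T, hTT, Matrix.one_mul]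
  refine ⟨⟨cliffSign_sign q p, fun i => ?_, fun i j hij => ?_⟩, fun i => ?_⟩
  · rw [hmul, h.sq, cliffSign_finAddFlip, neg_smul, neg_neg]
  · rw [hmul, hmul, h.anti _ _ (finAddFlip.injective.ne hij)]
  · rw [Matrix.transpose_mul, h.transpose, hT, cliffSign_finAddFlip, hTM, Matrix.smul_mul, neg_smul,
      smul_neg]

theorem IsSkewForm.swap {p q : ℕ} {M : Fin (p + q) → Matrix m m ℝ} {S T : Matrix m m ℝ}
    (hS : IsSkewForm S M) (hT : Tᵀ = T) (hTT : T * T = 1) (hST : S * T = T * S) :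
    IsSkewForm (S * T) fun i : Fin (q + p) => T * M (finAddFlip i) := by
  refine ⟨?_, hS.isUnit.mul (IsUnit.of_mul_eq_one _ hTT), fun i => ?_⟩
  · rw [Matrix.transpose_mul, hS.transpose, hT, hST]
  · rw [Matrix.transpose_mul, hT, Matrix.mul_assoc, hST, ← Matrix.mul_assoc T, hTT, Matrix.one_mul,
      hS.skew, ← hST, Matrix.mul_assoc, ← Matrix.mul_assoc T, hTT, Matrix.one_mul]

end Structure

section Dimension

open scoped Matrix
open Complex (I)

variable {m : Type} [Fintype m] [DecidableEq m]

theorem prod_cliffSign (q : ℕ) :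
    ((List.finRange (q + 4)).map (cliffSign q 4)).prod = (-1 : ℝ) ^ q := by
  rw [← Fin.prod_univ_def, Fin.prod_univ_add]
  simp [cliffSign]

theorem prod_one_add_cliffSign (q : ℕ) (τ : ℝ) :
    ((List.finRange (q + 4)).map fun a => 1 + I * ((τ * cliffSign q 4 a : ℝ) : ℂ)).prod =
      (1 - I * τ) ^ q * (1 + I * τ) ^ 4 := by
  rw [← Fin.prod_univ_def, Fin.prod_univ_add]
  simp [cliffSign, sub_eq_add_neg]

theorem one_sub_I_mul_one_add_I : (1 - I) * (1 + I) = 2 := by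
  linear_combination -Complex.I_mul_I

theorem one_sub_I_pow_eight : (1 - I) ^ 8 = 16 := by
  have h2 : (1 - I) ^ 2 = -2 * I := by linear_combination Complex.I_sq
  rw [show (8 : ℕ) = 2 * 4 from rfl, pow_mul, h2, mul_pow, Complex.I_pow_four]
  norm_num

theorem one_add_I_pow_eight : (1 + I) ^ 8 = 16 := by
  have h2 : (1 + I) ^ 2 = 2 * I := by linear_combination Complex.I_sq
  rw [show (8 : ℕ) = 2 * 4 from rfl, pow_mul, h2, mul_pow, Complex.I_pow_four]
  norm_num

theorem re_reduction (r : ℕ) :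
    ((1 - I) ^ (r + 1)).re = 16 ^ (r / 8) * ((1 - I) ^ (r % 8 + 1)).re ∧
      ((1 - I) * (1 + I) ^ r).re = 16 ^ (r / 8) * ((1 - I) * (1 + I) ^ (r % 8)).re := by
  have hcast : (16 : ℂ) ^ (r / 8) = ((16 ^ (r / 8) : ℝ) : ℂ) := by push_cast; rfl
  constructor
  · rw [← Complex.re_ofReal_mul, ← hcast, ← one_sub_I_pow_eight, ← pow_mul, ← pow_add, ← add_assoc,
      Nat.div_add_mod]
  · rw [← Complex.re_ofReal_mul, ← hcast, ← one_add_I_pow_eight, ← pow_mul, mul_left_comm,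
      ← pow_add, Nat.div_add_mod]

theorem re_le_of_good {r : ℕ} (hr : r % 8 = 0 ∨ r % 8 = 1 ∨ r % 8 = 2 ∨ r % 8 = 4) :
    ((1 - I) ^ (r + 1)).re ≤ ((1 - I) * (1 + I) ^ r).re := by
  rw [(re_reduction r).1, (re_reduction r).2]
  refine mul_le_mul_of_nonneg_left ?_ (by positivity)
  rcases hr with h | h | h | h <;> rw [h] <;> norm_num [pow_succ]

theorem re_lt_of_bad {r : ℕ} (hr : r % 8 = 5 ∨ r % 8 = 6) :
    ((1 - I) * (1 + I) ^ r).re < ((1 - I) ^ (r + 1)).re := by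
  rw [(re_reduction r).1, (re_reduction r).2]
  refine mul_lt_mul_of_pos_left ?_ (by positivity)
  rcases hr with h | h <;> rw [h] <;> norm_num [pow_succ]

theorem volume_sign {r : ℕ} :
    (r % 4 = 1 → (-1 : ℝ) ^ ((r + 4 + 4) * (r + 4 + 4 - 1) / 2) * (-1) ^ (r + 4) = -1) ∧
    (r % 4 = 3 → (-1 : ℝ) ^ ((r + 4 + 4) * (r + 4 + 4 - 1) / 2) * (-1) ^ (r + 4) = 1) := by
  constructor <;> intro h
  · obtain ⟨j, rfl⟩ : ∃ j, r = 4 * j + 1 := ⟨r / 4, by omega⟩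
    rw [show (4 * j + 1 + 4 + 4) * (4 * j + 1 + 4 + 4 - 1) / 2 = 2 * ((4 * j + 9) * (j + 2)) by
      rw [show 4 * j + 1 + 4 + 4 - 1 = 4 * j + 8 by omega]
      exact Nat.div_eq_of_eq_mul_right two_pos (by ring),
      show 4 * j + 1 + 4 = 2 * (2 * j + 2) + 1 by ring]
    simp [pow_succ, pow_mul]
  · obtain ⟨j, rfl⟩ : ∃ j, r = 4 * j + 3 := ⟨r / 4, by omega⟩
    rw [show (4 * j + 3 + 4 + 4) * (4 * j + 3 + 4 + 4 - 1) / 2 =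
        2 * (4 * j * j + 21 * j + 27) + 1 by
      rw [show 4 * j + 3 + 4 + 4 - 1 = 4 * j + 10 by omega]
      exact Nat.div_eq_of_eq_mul_right two_pos (by ring),
      show 4 * j + 3 + 4 = 2 * (2 * j + 3) + 1 by ring]
    simp [pow_succ, pow_mul]

theorem IsOrthClifford.trace_eq_zero {r : ℕ} {M : Fin (r + 4 + 4) → Matrix m m ℝ}
    (h : IsOrthClifford (cliffSign (r + 4) 4) M) (hr : r % 4 ≠ 3)
    (s : List (Fin (r + 4 + 4))) (hs : s.Sublist (List.finRange _)) (hne : s ≠ []) :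
    (listProd M s).trace = 0 := by
  refine h.trace_listProd_eq_zero (List.nodup_finRange _) ?_ hs hne
  rw [List.length_finRange, prod_cliffSign]
  by_cases h1 : r % 4 = 1
  · exact Or.inr (volume_sign.1 h1)
  · left
    rw [Nat.even_iff]
    omega

theorem IsOrthClifford.finrank_invForms_eq {r : ℕ} {M : Fin (r + 4 + 4) → Matrix m m ℝ}
    (h : IsOrthClifford (cliffSign (r + 4) 4) M) (hr : r % 4 ≠ 3) :
    (Module.finrank ℝ (invForms 1 M) : ℝ) * 2 ^ (r + 9) =
        (Fintype.card m : ℝ) ^ 2 + Fintype.card m * (16 * ((1 - I) ^ (r + 1)).re) ∧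
      (Module.finrank ℝ (invForms (-1) M) : ℝ) * 2 ^ (r + 9) =
        (Fintype.card m : ℝ) ^ 2 + Fintype.card m * (16 * ((1 - I) * (1 + I) ^ r).re) := by
  have key := fun τ hτ => h.finrank_invForms (τ := τ) hτ (List.nodup_finRange _) List.mem_finRange
    (h.trace_eq_zero hr)
  simp only [List.length_finRange, prod_one_add_cliffSign] at key
  have h24 : (1 - I) ^ 4 * (1 + I) ^ 4 = 16 := by
    rw [← mul_pow, one_sub_I_mul_one_add_I]
    norm_num
  constructor
  · rw [key 1 (by norm_num),
      show (1 - I) * ((1 - I * ((1 : ℝ) : ℂ)) ^ (r + 4) * (1 + I * ((1 : ℝ) : ℂ)) ^ 4) =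
        ((16 : ℝ) : ℂ) * (1 - I) ^ (r + 1) by
          push_cast
          rw [← h24]
          ring, Complex.re_ofReal_mul]
  · rw [key (-1) (by norm_num),
      show (1 - I) * ((1 - I * ((-1 : ℝ) : ℂ)) ^ (r + 4) * (1 + I * ((-1 : ℝ) : ℂ)) ^ 4) =
        ((16 : ℝ) : ℂ) * ((1 - I) * (1 + I) ^ r) by
          push_cast
          rw [← h24]
          ring, Complex.re_ofReal_mul]

theorem mem_invForms_iff {ι : Type} {σ : ι → ℝ} {M : ι → Matrix m m ℝ}
    (h : IsOrthClifford σ M) {τ : ℝ} {X : Matrix m m ℝ} :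
    X ∈ invForms τ M ↔ Xᵀ = X ∧ ∀ i, X * M i = τ • (M i * X) := by
  refine and_congr_right fun _ => forall_congr' fun i => ⟨fun hX => ?_, fun hX => ?_⟩
  · rw [← Matrix.mul_smul, ← hX, ← Matrix.mul_assoc, ← Matrix.mul_assoc, h.mul_transpose,
      Matrix.one_mul]
  · rw [Matrix.mul_assoc, hX, Matrix.mul_smul, ← Matrix.mul_assoc, h.transpose_mul, Matrix.one_mul]

theorem IsOrthClifford.exists_involution [Nonempty m] {r : ℕ}
    (hr : r % 8 = 0 ∨ r % 8 = 1 ∨ r % 8 = 2 ∨ r % 8 = 4)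
    {M : Fin (r + 4 + 4) → Matrix m m ℝ}
    (h : IsOrthClifford (cliffSign (r + 4) 4) M) (hirr : IsIrred M) :
    ∃ T : Matrix m m ℝ, Tᵀ = T ∧ T * T = 1 ∧ ∀ i, T * M i = -(M i * T) := by
  have hlt : (0 : ℝ) < Module.finrank ℝ (invForms 1 M) := by
    rw [Nat.cast_pos, Module.finrank_pos_iff, Submodule.nontrivial_iff_ne_bot]
    intro hb
    have : (1 : Matrix m m ℝ) ∈ invForms 1 M := by
      simp [mem_invForms_iff h]
    rw [hb, Submodule.mem_bot] at this
    exact one_ne_zero this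
  have hpos : invForms (-1) M ≠ ⊥ := by
    intro hb
    obtain ⟨h1, h2⟩ := h.finrank_invForms_eq (by omega)
    rw [hb, finrank_bot, Nat.cast_zero, zero_mul] at h2
    have := re_le_of_good hr
    have hc : (0 : ℝ) ≤ Fintype.card m := by positivity
    have := mul_pos hlt (show (0 : ℝ) < 2 ^ (r + 9) by positivity)
    nlinarith
  obtain ⟨T, hT, hT0⟩ := Submodule.exists_mem_ne_zero_of_ne_bot hpos
  rw [mem_invForms_iff h] at hT
  obtain ⟨hTt, hTM⟩ := hT
  simp only [neg_one_smul] at hTM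
  obtain ⟨c, hc⟩ := hirr.exists_eq_smul_one (X := T * T)
    (by rw [Matrix.transpose_mul, hTt]) fun i => by
      rw [Matrix.mul_assoc, hTM, Matrix.mul_neg, ← Matrix.mul_assoc, hTM, Matrix.neg_mul, neg_neg,
        Matrix.mul_assoc]
  have hcpos := pos_of_mul_self_eq_smul hTt hT0 hc
  refine ⟨(√c)⁻¹ • T, ?_, ?_, fun i => ?_⟩
  · rw [Matrix.transpose_smul, hTt]
  · rw [Matrix.smul_mul, Matrix.mul_smul, hc, smul_smul, smul_smul, ← mul_inv,
      Real.mul_self_sqrt hcpos.le, inv_mul_cancel₀ hcpos.ne', one_smul]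
  · rw [Matrix.smul_mul, Matrix.mul_smul, hTM, smul_neg]

theorem IsOrthClifford.mod_of_involution [Nonempty m] {r : ℕ}
    {M : Fin (r + 4 + 4) → Matrix m m ℝ}
    (h : IsOrthClifford (cliffSign (r + 4) 4) M) (hirr : IsIrred M) {T : Matrix m m ℝ}
    (hT : Tᵀ = T) (hTT : T * T = 1) (hTM : ∀ i, T * M i = -(M i * T)) :
    r % 8 = 0 ∨ r % 8 = 1 ∨ r % 8 = 2 ∨ r % 8 = 4 := by
  have hT0 : T ≠ 0 := by
    rintro rfl
    simp at hTT
  by_contra hr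
  by_cases hr3 : r % 4 = 3
  · have hodd : (List.finRange (r + 4 + 4)).length % 2 = 1 := by
      rw [List.length_finRange]
      omega
    have hsq := h.listProd_mul_self (List.nodup_finRange (r + 4 + 4))
    rw [List.length_finRange, prod_cliffSign, volume_sign.2 hr3, one_smul] at hsq
    have ht : (listProd M (List.finRange (r + 4 + 4)))ᵀ =
        listProd M (List.finRange (r + 4 + 4)) := by
      calc _ = (listProd M (List.finRange (r + 4 + 4)))ᵀ * listProd M (List.finRange (r + 4 + 4)) *
            listProd M (List.finRange (r + 4 + 4)) := by
              rw [Matrix.mul_assoc, hsq, Matrix.mul_one]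
        _ = _ := by rw [h.listProd_transpose_mul, Matrix.one_mul]
    obtain ⟨c, hc⟩ := hirr.exists_eq_smul_one ht fun i => by
      rw [h.mul_listProd_of_mem (List.nodup_finRange _) (List.mem_finRange i),
        Even.neg_one_pow (Nat.even_iff.2 (by omega)), one_smul]
    have hanti := mul_listProd_of_anti hTM (List.finRange (r + 4 + 4))
    rw [Odd.neg_one_pow (Nat.odd_iff.2 hodd), hc, Matrix.mul_smul, Matrix.smul_mul, Matrix.mul_one,
      Matrix.one_mul, neg_one_smul, eq_neg_iff_add_eq_zero,
      ← two_smul ℝ, smul_smul, smul_eq_zero] at hanti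
    rcases hanti with h0 | h0
    · obtain rfl : c = 0 := by linarith
      rw [hc] at hsq
      simp at hsq
    · exact hT0 h0
  · obtain ⟨h1, h2⟩ := h.finrank_invForms_eq hr3
    have hle : Module.finrank ℝ (invForms 1 M) ≤ 1 := by
      refine finrank_le_one ⟨1, by simp [mem_invForms_iff h]⟩ ?_
      rintro ⟨X, hX⟩
      have hX' := (mem_invForms_iff h).1 hX
      obtain ⟨c, hc⟩ := hirr.exists_eq_smul_one hX'.1 (by simpa using hX'.2)
      exact ⟨c, Subtype.ext hc.symm⟩
    have hpos : 1 ≤ Module.finrank ℝ (invForms (-1) M) := by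
      rw [Nat.one_le_iff_ne_zero, ← Nat.pos_iff_ne_zero, Module.finrank_pos_iff,
        Submodule.nontrivial_iff_ne_bot]
      intro hb
      have : T ∈ invForms (-1) M := by simpa [mem_invForms_iff h] using ⟨hT, hTM⟩
      rw [hb, Submodule.mem_bot] at this
      exact hT0 this
    have hlt := re_lt_of_bad (r := r) (by omega)
    have hc : (0 : ℝ) < Fintype.card m := by exact_mod_cast Fintype.card_pos
    have hle' : (Module.finrank ℝ (invForms 1 M) : ℝ) ≤ Module.finrank ℝ (invForms (-1) M) := by
      exact_mod_cast hle.trans hpos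
    have := mul_le_mul_of_nonneg_right hle' (show (0 : ℝ) ≤ 2 ^ (r + 9) by positivity)
    rw [h1, h2] at this
    have := mul_lt_mul_of_pos_left hlt hc
    linarith

end Dimension

section Isomorphism

open scoped Matrix

theorem mulVec_dotProduct_eq {m m' : Type} [Fintype m] [Fintype m'] (A : Matrix m m' ℝ)
    (x : m' → ℝ) (y : m → ℝ) : (A *ᵥ x) ⬝ᵥ y = x ⬝ᵥ (Aᵀ *ᵥ y) := by
  rw [Matrix.mulVec_transpose, dotProduct_comm, Matrix.dotProduct_mulVec, dotProduct_comm]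

theorem bracket_apply {p q d : ℕ} {V : Type} [AddCommGroup V] [Module ℝ V]
    {B : V →ₗ[ℝ] V →ₗ[ℝ] ℝ} {J : (Fin (p + q) → ℝ) →ₗ[ℝ] V →ₗ[ℝ] V}
    {br : V →ₗ[ℝ] V →ₗ[ℝ] (Fin (p + q) → ℝ)} (hbr : IsHBracket p q V B J br)
    {e : V ≃ₗ[ℝ] (Fin d → ℝ)} {M : Fin (p + q) → Matrix (Fin d) (Fin d) ℝ}
    {S : Matrix (Fin d) (Fin d) ℝ} (hM : ∀ i x, e (J (Pi.single i 1) x) = M i *ᵥ e x)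
    (hB : ∀ x y, B x y = e x ⬝ᵥ (S *ᵥ e y)) (i : Fin (p + q)) (x y : V) :
    br x y i = -cliffSign p q i * (e x ⬝ᵥ (((M i)ᵀ * S) *ᵥ e y)) := by
  have h := hbr (Pi.single i 1) x y
  have hsq : cliffSign p q i * cliffSign p q i = 1 := by
    rcases cliffSign_sign p q i with h | h <;> rw [h] <;> norm_num
  rw [sform_single_left, hB, hM, mulVec_dotProduct_eq, Matrix.mulVec_mulVec] at h
  linear_combination -cliffSign p q i * h + (-br x y i) * hsq

theorem exists_lieIso {p q d : ℕ} {V1 V2 : Type} [AddCommGroup V1] [Module ℝ V1]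
    [AddCommGroup V2] [Module ℝ V2]
    {br1 : V1 →ₗ[ℝ] V1 →ₗ[ℝ] (Fin (p + q) → ℝ)} {br2 : V2 →ₗ[ℝ] V2 →ₗ[ℝ] (Fin (q + p) → ℝ)}
    (e1 : V1 ≃ₗ[ℝ] (Fin d → ℝ)) (e2 : V2 ≃ₗ[ℝ] (Fin d → ℝ))
    {M1 : Fin (p + q) → Matrix (Fin d) (Fin d) ℝ} {M2 : Fin (q + p) → Matrix (Fin d) (Fin d) ℝ}
    {S1 S2 X : Matrix (Fin d) (Fin d) ℝ} (hX : IsUnit X) {c : ℝ} (hc : c ≠ 0)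
    (h1 : ∀ i x y, br1 x y i = -cliffSign p q i * (e1 x ⬝ᵥ (((M1 i)ᵀ * S1) *ᵥ e1 y)))
    (h2 : ∀ i x y, br2 x y i = -cliffSign q p i * (e2 x ⬝ᵥ (((M2 i)ᵀ * S2) *ᵥ e2 y)))
    (h : ∀ i, Xᵀ * ((M2 (finAddFlip i))ᵀ * S2) * X = c • ((M1 i)ᵀ * S1)) :
    ∃ f : (V1 × (Fin (p + q) → ℝ)) ≃ₗ[ℝ] (V2 × (Fin (q + p) → ℝ)), IsLieIso br1 br2 f := by
  let A : V1 ≃ₗ[ℝ] V2 := (e1.trans (Matrix.toLinearEquiv' X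
    (Matrix.invertibleOfIsUnitDet X ((Matrix.isUnit_iff_isUnit_det X).1 hX)))).trans e2.symm
  have hA : ∀ x, e2 (A x) = X *ᵥ e1 x := fun x => e2.apply_symm_apply _
  let C : (Fin (p + q) → ℝ) ≃ₗ[ℝ] (Fin (q + p) → ℝ) :=
    (LinearEquiv.funCongrLeft ℝ ℝ (finAddFlip : Fin (q + p) ≃ Fin (p + q))).trans
      (LinearEquiv.smulOfNeZero ℝ _ (-c) (neg_ne_zero.2 hc))
  have hC : ∀ z j, C z j = -c * z (finAddFlip j) := fun z j => rfl
  refine ⟨A.prodCongr C, fun x y => Prod.ext (map_zero A) (funext fun j => ?_)⟩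
  obtain ⟨i, rfl⟩ := (finAddFlip : Fin (p + q) ≃ Fin (q + p)).surjective j
  have hflip : (finAddFlip (finAddFlip i : Fin (q + p)) : Fin (p + q)) = i :=
    (finAddFlip : Fin (p + q) ≃ Fin (q + p)).symm_apply_apply i
  change C (br1 x.1 y.1) (finAddFlip i) = br2 (A x.1) (A y.1) (finAddFlip i)
  rw [hC, h1, h2, hA, hA, hflip, cliffSign_finAddFlip, mulVec_dotProduct_eq,
    Matrix.mulVec_mulVec, Matrix.mulVec_mulVec,
    h, Matrix.smul_mulVec, dotProduct_smul, smul_eq_mul]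
  ring

theorem exists_isUnit_intertwiner {r d : ℕ} (hd : 0 < d) (hr : r % 4 ≠ 3)
    {M M' : Fin (r + 4 + 4) → Matrix (Fin d) (Fin d) ℝ}
    (h : IsOrthClifford (cliffSign (r + 4) 4) M) (h' : IsOrthClifford (cliffSign (r + 4) 4) M')
    (hirr : IsIrred M) : ∃ X : Matrix (Fin d) (Fin d) ℝ, IsUnit X ∧ ∀ i, X * M i = M' i * X := by
  have : Nonempty (Fin d) := ⟨⟨0, hd⟩⟩
  obtain ⟨X, hX0, hX⟩ := h'.exists_intertwiner h List.mem_finRange (h.trace_eq_zero hr)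
  refine ⟨X, ?_, hX⟩
  rcases hirr (LinearMap.ker X.mulVecLin) fun i x hx => by
    rw [LinearMap.mem_ker, Matrix.mulVecLin_apply] at hx ⊢
    rw [Matrix.mulVec_mulVec, hX, ← Matrix.mulVec_mulVec, hx, Matrix.mulVec_zero] with hb | ht
  · exact Matrix.mulVec_injective_iff_isUnit.1 (LinearMap.ker_eq_bot.1 hb)
  · rw [LinearMap.ker_eq_top] at ht
    exact absurd (Matrix.toLin'.map_eq_zero_iff.1 ht) hX0

theorem IsSkewForm.congr {ι m : Type} [Fintype m] [DecidableEq m] {M M' : ι → Matrix m m ℝ}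
    {S X : Matrix m m ℝ} (hS : IsSkewForm S M') (hX : IsUnit X) (h : ∀ i, X * M i = M' i * X) :
    IsSkewForm (Xᵀ * S * X) M := by
  refine ⟨?_, ?_, fun i => ?_⟩
  · simp [Matrix.transpose_mul, hS.transpose, Matrix.mul_assoc]
  · exact ((Matrix.isUnit_transpose X).2 hX |>.mul hS.isUnit).mul hX
  · calc (M i)ᵀ * (Xᵀ * S * X) = (X * M i)ᵀ * S * X := by
          simp only [Matrix.transpose_mul, Matrix.mul_assoc]
      _ = Xᵀ * ((M' i)ᵀ * S) * X := by
          rw [h]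
          simp only [Matrix.transpose_mul, Matrix.mul_assoc]
      _ = -(Xᵀ * S * (X * M i)) := by
          rw [hS.skew, h]
          simp only [Matrix.mul_neg, Matrix.neg_mul, Matrix.mul_assoc]
      _ = _ := by rw [Matrix.mul_assoc (Xᵀ * S)]

end Isomorphism

open scoped Matrix

theorem stmt10 (r : ℕ)
    (V1 : Type) [AddCommGroup V1] [Module ℝ V1]
    (B1 : V1 →ₗ[ℝ] V1 →ₗ[ℝ] ℝ)
    (J1 : (Fin ((r + 4) + 4) → ℝ) →ₗ[ℝ] V1 →ₗ[ℝ] V1)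
    (br1 : V1 →ₗ[ℝ] V1 →ₗ[ℝ] (Fin ((r + 4) + 4) → ℝ))
    (hadm1 : IsMinimalAdmissible (r + 4) 4 V1 B1 J1)
    (hbr1 : IsHBracket (r + 4) 4 V1 B1 J1 br1)
    (V2 : Type) [AddCommGroup V2] [Module ℝ V2]
    (B2 : V2 →ₗ[ℝ] V2 →ₗ[ℝ] ℝ)
    (J2 : (Fin (4 + (r + 4)) → ℝ) →ₗ[ℝ] V2 →ₗ[ℝ] V2)
    (br2 : V2 →ₗ[ℝ] V2 →ₗ[ℝ] (Fin (4 + (r + 4)) → ℝ))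
    (hadm2 : IsMinimalAdmissible 4 (r + 4) V2 B2 J2)
    (hbr2 : IsHBracket 4 (r + 4) V2 B2 J2 br2)
    :
    (∃ f : (V1 × (Fin ((r + 4) + 4) → ℝ)) ≃ₗ[ℝ] (V2 × (Fin (4 + (r + 4)) → ℝ)),
      IsLieIso br1 br2 f) ↔
    (r % 8 = 0 ∨ r % 8 = 1 ∨ r % 8 = 2 ∨ r % 8 = 4) := by
  obtain ⟨d1, hd1, e1, M1, S1, h1, hS1, hJ1, hB1⟩ := hadm1.1.exists_matrix
  obtain ⟨d2, hd2, e2, M2, S2, h2, hS2, hJ2, hB2⟩ := hadm2.1.exists_matrix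
  have hf1 : Module.finrank ℝ V1 = d1 := by rw [e1.finrank_eq, Module.finrank_fin_fun]
  have hf2 : Module.finrank ℝ V2 = d2 := by rw [e2.finrank_eq, Module.finrank_fin_fun]
  have hmin1 := hadm1.2
  have hmin2 := hadm2.2
  rw [hf1] at hmin1
  rw [hf2] at hmin2
  have : Nonempty (Fin d1) := ⟨⟨0, hd1⟩⟩
  have : Nonempty (Fin d2) := ⟨⟨0, hd2⟩⟩
  have hirr1 := h1.isIrred_of_minimal hmin1
  obtain ⟨T, hT, hTT, hTM, hST⟩ := hS2.exists_involution h2 (hS2.isIrred_of_minimal h2 hmin2)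
  have h' := h2.swap hT hTT hTM
  have hS' : IsSkewForm (S2 * T) fun i : Fin (r + 4 + 4) => T * M2 (finAddFlip i) :=
    hS2.swap hT hTT hST
  constructor
  · rintro ⟨f, -⟩
    have := hadm1.1.1
    have := hadm2.1.1
    have hdim := f.finrank_eq
    rw [Module.finrank_prod, Module.finrank_prod, hf1, hf2, Module.finrank_fin_fun,
      Module.finrank_fin_fun] at hdim
    obtain rfl : d1 = d2 := by omega
    refine h'.mod_of_involution (h'.isIrred_of_minimal hmin1) hT hTT fun i => ?_
    rw [hTM, Matrix.mul_neg, Matrix.neg_mul, ← Matrix.mul_assoc, hTM, Matrix.neg_mul]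
  · intro hr
    obtain ⟨T1, hT1, hTT1, hTM1⟩ := h1.exists_involution hr hirr1
    have hST1 := (hS1.smul_and_commute hS1 h1 hirr1).2 T1 hTM1
    obtain rfl : d1 = d2 := le_antisymm (hS'.finrank_le hd2 h' hmin1)
      ((hS1.swap hT1 hTT1 hST1).finrank_le hd1 (h1.swap hT1 hTT1 hTM1) hmin2)
    obtain ⟨X, hX, hXM⟩ := exists_isUnit_intertwiner hd1 (by omega) h1 h' hirr1
    obtain ⟨c, hc, hcS⟩ := (hS1.smul_and_commute (hS'.congr hX hXM) h1 hirr1).1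
    refine exists_lieIso e1 e2 hX hc (bracket_apply hbr1 hJ1 hB1) (bracket_apply hbr2 hJ2 hB2)
      fun i => ?_
    calc Xᵀ * ((M2 (finAddFlip i))ᵀ * S2) * X
        = (T * M2 (finAddFlip i) * X)ᵀ * (S2 * T) * X := by
          rw [hST, Matrix.transpose_mul, Matrix.transpose_mul, hT]
          simp only [Matrix.mul_assoc]
          rw [← Matrix.mul_assoc T T, hTT, Matrix.one_mul]
      _ = c • ((M1 i)ᵀ * S1) := by
          rw [← hXM, Matrix.transpose_mul, Matrix.mul_assoc, Matrix.mul_assoc,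
            ← Matrix.mul_assoc Xᵀ, hcS, Matrix.mul_smul]
end

section
/- Let r ≥ 0 with r ≡ 0, 1, 2, or 4 (mod 8) and let t₁, t₂, t₃ ≥ 0 be integers. Then every pseudo H-type Lie algebra n_{r+4t₁+8t₂, 8t₃+4t₁} built on a minimal admissible Cl_{r+4t₁+8t₂, 8t₃+4t₁}-module is isomorphic as a Lie algebra to every pseudo H-type Lie algebra n_{8t₃+4t₁, r+4t₁+8t₂} built on a minimal admissible Cl_{8t₃+4t₁, r+4t₁+8t₂}-module. -/
/-- The product of the generators `J i` along a word `l`. -/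
def word {ι A : Type*} [Monoid A] (J : ι → A) (l : List ι) : A := (l.map J).prod

/-- The parity vector of a word. -/
def par {ι : Type*} [DecidableEq ι] (l : List ι) (i : ι) : ZMod 2 := (l.count i : ZMod 2)

/-- The sign character of `ZMod 2`. -/
def paritySign (a : ZMod 2) : ℝ := if a = 0 then 1 else -1

/-- The generators `J i` anticommute and satisfy `J i ^ 2 = -ε i`. -/
structure IsClifford_s11 {ι A : Type*} [Ring A] [Algebra ℝ A] (ε : ι → ℝ) (J : ι → A) : Prop where
  ne_zero : ∀ i, ε i ≠ 0
  sq : ∀ i, J i * J i = (-ε i) • (1 : A)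
  anti : ∀ i j, i ≠ j → J i * J j = -(J j * J i)

/-- The words `P k` span a doubly even binary code, compatible with the signature `ε`, whose dual
contains no symmetric Clifford monomials besides the code itself; the words `F k` form a dual
family of sign flips. -/
structure IsCliffordCode {ι κ : Type*} [Fintype ι] [DecidableEq ι] (ε : ι → ℝ)
    (P F : κ → List ι) : Prop where
  length : ∀ k, (P k).length = 4
  nodup : ∀ k, (P k).Nodup
  sign : ∀ k, ((P k).map ε).prod = 1
  comm : ∀ k k', ((P k').map (par (P k))).sum = 0
  flip : ∀ k, ((F k).map (par (P k))).sum = 1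
  flip_ne : ∀ k k', k ≠ k' → ((F k).map (par (P k'))).sum = 0
  complete : ∀ f : ι → ZMod 2, (∀ k, ∑ i, f i * par (P k) i = 0) →
    ∃ R : List ι, (R = [] ∨ (∃ i, R = [i]) ∨ ∃ i j, i ≠ j ∧ R = [i, j]) ∧
      ∃ s : Finset κ, ∀ i, par R i + f i + ∑ k ∈ s, par (P k) i = 0

/-- Every `J i` is skew with respect to the symmetric form `B`. -/
structure IsSkewFamily {ι V : Type*} [AddCommGroup V] [Module ℝ V]
    (B : V →ₗ[ℝ] V →ₗ[ℝ] ℝ) (J : ι → Module.End ℝ V) : Prop where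
  symm : ∀ v w, B v w = B w v
  skew : ∀ i v w, B (J i v) w = -B v (J i w)

@[simp] theorem word_nil {ι A : Type*} [Monoid A] (J : ι → A) : word J [] = 1 := rfl

@[simp] theorem word_cons {ι A : Type*} [Monoid A] (J : ι → A) (i : ι) (l : List ι) :
    word J (i :: l) = J i * word J l := by simp [word]

theorem word_append {ι A : Type*} [Monoid A] (J : ι → A) (l m : List ι) :
    word J (l ++ m) = word J l * word J m := by
  simp [word]

section Words

variable {ι A : Type*} [Ring A] [Algebra ℝ A] {ε : ι → ℝ} {J : ι → A}

theorem paritySign_add (a b : ZMod 2) :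
    paritySign (a + b) = paritySign a * paritySign b := by
  have : ∀ a b : ZMod 2, a + b = 0 ↔ a = b := by decide
  have h2 : ∀ a : ZMod 2, a = 0 ∨ a = 1 := by decide
  rcases h2 a with rfl | rfl <;> rcases h2 b with rfl | rfl <;> simp [paritySign, this]

theorem IsClifford_s11.mul_reverse (h : IsClifford_s11 ε J) (l : List ι) :
    ∃ c : ℝ, c ≠ 0 ∧ word J l * word J l.reverse = c • 1 := by
  induction l with
  | nil => exact ⟨1, one_ne_zero, by simp⟩
  | cons i t ih =>
    obtain ⟨c, hc, ih⟩ := ih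
    refine ⟨c * -ε i, mul_ne_zero hc (neg_ne_zero.2 (h.ne_zero i)), ?_⟩
    rw [List.reverse_cons, word_append, word_cons, mul_assoc, ← mul_assoc (word J t), ih]
    simp [h.sq, mul_smul]

theorem IsClifford_s11.perm (h : IsClifford_s11 ε J) {l m : List ι} (hp : l.Perm m) :
    ∃ c : ℝ, word J l = c • word J m := by
  classical
  induction hp with
  | nil => exact ⟨1, by simp⟩
  | cons i _ ih => obtain ⟨c, ih⟩ := ih; exact ⟨c, by simp [ih]⟩
  | swap i j t =>
    by_cases hij : j = i
    · subst hij; exact ⟨1, by simp⟩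
    · exact ⟨-1, by simp [← mul_assoc, h.anti j i hij]⟩
  | trans _ _ ih₁ ih₂ =>
    obtain ⟨c, hc⟩ := ih₁
    obtain ⟨d, hd⟩ := ih₂
    exact ⟨c * d, by rw [hc, hd, mul_smul]⟩

theorem IsClifford_s11.reverse_four (h : IsClifford_s11 ε J) {m : List ι} (hm : m.length = 4)
    (hn : m.Nodup) : word J m.reverse = word J m := by
  obtain ⟨a, b, c, d, rfl⟩ := List.length_eq_four.1 hm
  simp at hn
  obtain ⟨⟨hab, hac, had⟩, ⟨hbc, hbd⟩, hcd⟩ := hn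
  have e1 := h.anti d c (Ne.symm hcd)
  have e2 := h.anti b a (Ne.symm hab)
  have e3 := h.anti d a (Ne.symm had)
  have e4 := h.anti d b (Ne.symm hbd)
  have e5 := h.anti c a (Ne.symm hac)
  have e6 := h.anti c b (Ne.symm hbc)
  simp only [List.reverse_cons, List.reverse_nil, List.nil_append, List.cons_append, word_cons,
    word_nil, mul_one]
  calc J d * (J c * (J b * J a)) = (J d * J c) * (J b * J a) := by simp only [mul_assoc]
    _ = J c * (J d * J a) * J b := by rw [e1, e2, neg_mul_neg]; simp only [mul_assoc]
    _ = -((J c * J a) * (J d * J b)) := by rw [e3]; simp only [mul_assoc, mul_neg, neg_mul]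
    _ = -(J a * (J c * J b) * J d) := by
      rw [e5, e4]; simp only [mul_assoc, mul_neg, neg_mul, neg_neg]
    _ = J a * (J b * (J c * J d)) := by
      rw [e6]; simp only [mul_assoc, mul_neg, neg_mul, neg_neg]

theorem IsClifford_s11.four_mul_self (h : IsClifford_s11 ε J) {m : List ι} (hm : m.length = 4)
    (hn : m.Nodup) (hs : (m.map ε).prod = 1) : word J m * word J m = 1 := by
  have hr := h.reverse_four hm hn
  nth_rewrite 2 [← hr]
  obtain ⟨a, b, c, d, rfl⟩ := List.length_eq_four.1 hm
  simp only [List.map_cons, List.map_nil, List.prod_cons, List.prod_nil, mul_one] at hs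
  simp only [List.reverse_cons, List.reverse_nil, List.nil_append, List.cons_append, word_cons,
    word_nil, mul_one]
  calc J a * (J b * (J c * J d)) * (J d * (J c * (J b * J a)))
      = J a * (J b * (J c * (J d * J d) * J c) * J b) * J a := by simp only [mul_assoc]
    _ = (ε a * (ε b * (ε c * ε d))) • (1 : A) := by
      simp only [h.sq, mul_smul_comm, smul_mul_assoc, mul_one, smul_smul]
      congr 1; ring
    _ = 1 := by rw [hs, one_smul]

variable [DecidableEq ι]

theorem par_append (l m : List ι) (i : ι) : par (l ++ m) i = par l i + par m i := by
  simp [par]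

theorem par_cons (j : ι) (l : List ι) (i : ι) :
    par (j :: l) i = par l i + if j = i then 1 else 0 := by
  by_cases h : j = i <;> simp [par, h]

theorem IsClifford_s11.word_of_par_eq_zero (h : IsClifford_s11 ε J) :
    ∀ (n : ℕ) (l : List ι), l.length ≤ n → (∀ i, par l i = 0) → ∃ c : ℝ, word J l = c • 1 := by
  intro n
  induction n with
  | zero =>
    intro l hl _
    obtain rfl : l = [] := by simpa using hl
    exact ⟨1, by simp⟩
  | succ n ih =>
    intro l hl hp
    rcases l with _ | ⟨i, t⟩
    · exact ⟨1, by simp⟩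
    have hi : i ∈ t := by
      by_contra hi
      have := hp i
      simp [par, List.count_eq_zero_of_not_mem hi] at this
    have hperm := List.perm_cons_erase hi
    obtain ⟨c, hc⟩ := h.perm hperm
    have hlen : (t.erase i).length ≤ n := by
      have := hperm.length_eq
      simp at this hl
      omega
    obtain ⟨d, hd⟩ := ih (t.erase i) hlen (fun j => by
      have h1 := hp j
      have h2 : par t j = par (i :: t.erase i) j := by simp only [par, hperm.count_eq]
      rw [par_cons, h2, par_cons, add_assoc, CharTwo.add_self_eq_zero, add_zero] at h1
      exact h1)
    refine ⟨c * (-ε i * d), ?_⟩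
    rw [word_cons, hc, word_cons, mul_smul_comm, ← mul_assoc, h.sq, hd]
    simp only [smul_mul_assoc, one_mul, smul_smul]

theorem IsClifford_s11.generator_mul_word (h : IsClifford_s11 ε J) (i : ι) (m : List ι) :
    J i * word J m = paritySign (m.length + par m i) • (word J m * J i) := by
  induction m with
  | nil => simp [paritySign, par]
  | cons j t ih =>
    have h1 : J i * J j = paritySign (1 + if j = i then 1 else 0) • (J j * J i) := by
      by_cases hij : j = i
      · subst hij
        simp [paritySign, CharTwo.add_self_eq_zero]
      · simp [paritySign, hij, h.anti i j (Ne.symm hij)]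
    rw [word_cons, ← mul_assoc, h1, smul_mul_assoc, mul_assoc, ih, mul_smul_comm, smul_smul,
      ← paritySign_add, par_cons, mul_assoc]
    congr 2
    push_cast [List.length_cons]
    ring

theorem IsClifford_s11.word_mul_word (h : IsClifford_s11 ε J) {m : List ι} (hm : m.length = 4)
    (l : List ι) :
    word J l * word J m = paritySign (l.map (par m)).sum • (word J m * word J l) := by
  induction l with
  | nil => simp [paritySign]
  | cons i t ih =>
    have h4 : ((4 : ℕ) : ZMod 2) = 0 := by decide
    rw [word_cons, mul_assoc, ih, mul_smul_comm, ← mul_assoc, h.generator_mul_word, hm, h4,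
      zero_add, smul_mul_assoc, smul_smul, mul_assoc, List.map_cons, List.sum_cons,
      add_comm (par m i), paritySign_add]

end Words

section Modules

variable {ι κ : Type*} {V : Type*} [AddCommGroup V] [Module ℝ V]
  {ε : ι → ℝ} {B : V →ₗ[ℝ] V →ₗ[ℝ] ℝ} {J : ι → Module.End ℝ V}

theorem IsSkewFamily.eq_zero_of_eq_neg (h : IsSkewFamily B J) {i j : ι}
    (hij : J i * J j = -(J j * J i)) (v : V) : B (J i (J j v)) v = 0 := by
  have h1 := h.skew i (J j v) v
  have h2 := h.skew j v (J i v)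
  have h3 := h.symm (J j v) (J i v)
  have h4 : J i (J j v) = -J j (J i v) := by
    have := LinearMap.congr_fun hij v
    simpa using this
  have h5 := h.symm v (J j (J i v))
  rw [h4] at h1 ⊢
  simp only [map_neg, LinearMap.neg_apply] at h1 ⊢
  linarith

theorem IsSkewFamily.apply_self (h : IsSkewFamily B J) (i : ι) (v : V) : B (J i v) v = 0 := by
  have h1 := h.skew i v v
  have h2 := h.symm v (J i v)
  linarith

theorem IsSkewFamily.word_left (h : IsSkewFamily B J) (l : List ι) :
    ∀ v w, B (word J l v) w = (-1) ^ l.length * B v (word J l.reverse w) := by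
  induction l with
  | nil => simp
  | cons i t ih =>
    intro v w
    rw [word_cons, Module.End.mul_apply, h.skew, ih, List.reverse_cons, word_append,
      Module.End.mul_apply, List.length_cons, pow_succ]
    simp

theorem IsClifford_s11.word_injective (h : IsClifford_s11 ε J) (l : List ι) :
    Function.Injective fun v => word J l v := by
  obtain ⟨c, hc, hl⟩ := h.mul_reverse l.reverse
  rw [List.reverse_reverse] at hl
  intro x y hxy
  have := congrArg (fun v => word J l.reverse v) hxy
  simp only [← Module.End.mul_apply, hl] at this
  simpa [hc] using this

variable [Fintype ι] [DecidableEq ι] {P F : κ → List ι}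

theorem IsSkewFamily.code_selfAdjoint (h : IsSkewFamily B J) (hJ : IsClifford_s11 ε J)
    (hC : IsCliffordCode ε P F) (k : κ) (v w : V) :
    B (word J (P k) v) w = B v (word J (P k) w) := by
  rw [h.word_left, hC.length, hJ.reverse_four (hC.length k) (hC.nodup k)]
  norm_num

theorem sum_map_par_eq (l m : List ι) :
    (l.map (par m)).sum = ∑ i, par l i * par m i := by
  induction l with
  | nil => simp [par]
  | cons j t ih => simp [ih, par_cons, add_mul, Finset.sum_add_distrib, add_comm]

/-- For a vector fixed by the code, every Clifford monomial either acts on it by a scalar or maps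
it to an orthogonal vector, for every invariant form at once. -/
theorem IsCliffordCode.smul_or_ortho (hC : IsCliffordCode ε P F) (hJ : IsClifford_s11 ε J) {v : V}
    (hv : ∀ k, word J (P k) v = v) (l : List ι) :
    (∃ c : ℝ, word J l v = c • v) ∨
      ∀ B : V →ₗ[ℝ] V →ₗ[ℝ] ℝ, IsSkewFamily B J → B (word J l v) v = 0 := by
  by_cases hl : ∀ k, ∑ i, par l i * par (P k) i = 0
  · obtain ⟨R, hR, s, hs⟩ := hC.complete _ hl
    have hcode : ∀ t : List κ, word J (t.map P).flatten v = v := by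
      intro t
      induction t with
      | nil => simp
      | cons k t ih => simp [word_append, ih, hv]
    have hpar : ∀ (t : List κ) i, par (t.map P).flatten i = (t.map fun k => par (P k) i).sum := by
      intro t i
      induction t with
      | nil => simp [par]
      | cons k t ih => simp [par_append, ih]
    obtain ⟨c, hc⟩ := hJ.word_of_par_eq_zero _ (R ++ l ++ (s.toList.map P).flatten) le_rfl
      (fun i => by rw [par_append, par_append, hpar, Finset.sum_map_toList, hs i])
    have hRl : word J R (word J l v) = c • v := by
      have := LinearMap.congr_fun hc v
      simpa [word_append, hcode] using this
    rcases hR with rfl | ⟨i, rfl⟩ | ⟨i, j, hij, rfl⟩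
    · exact .inl ⟨c, by simpa using hRl⟩
    · right
      intro B hB
      have h1 := congrArg (J i) hRl
      have h2 := LinearMap.congr_fun (hJ.sq i) (word J l v)
      simp only [word_cons, word_nil, mul_one, Module.End.mul_apply, map_smul,
        LinearMap.smul_apply, Module.End.one_apply] at h1 h2
      rw [h2] at h1
      have h3 := congrArg (fun x => B x v) h1
      simpa [hB.apply_self, hJ.ne_zero i] using h3
    · right
      intro B hB
      have h1 := congrArg (fun x => J j (J i x)) hRl
      have h2 := LinearMap.congr_fun (hJ.sq i) (J j (word J l v))
      have h4 := LinearMap.congr_fun (hJ.sq j) (word J l v)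
      simp only [word_cons, word_nil, mul_one, Module.End.mul_apply, map_smul,
        LinearMap.smul_apply, Module.End.one_apply] at h1 h2 h4
      rw [h2, map_smul, h4] at h1
      have h3 := congrArg (fun x => B x v) h1
      simpa [hB.eq_zero_of_eq_neg (hJ.anti j i hij.symm), hJ.ne_zero i, hJ.ne_zero j] using h3
  · right
    intro B hB
    push Not at hl
    obtain ⟨k, hk⟩ := hl
    have h1 := LinearMap.congr_fun (hJ.word_mul_word (hC.length k) l) v
    rw [sum_map_par_eq] at h1
    simp only [Module.End.mul_apply, hv, LinearMap.smul_apply, paritySign, hk, if_false] at h1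
    have h2 := hB.code_selfAdjoint hJ hC k (word J l v) v
    rw [hv] at h2
    have h3 := congrArg (fun x => B x v) h1
    simp only [map_smul, LinearMap.smul_apply, smul_eq_mul] at h3
    linarith

variable [Fintype κ]

theorem IsCliffordCode.exists_fixed_vector [Nontrivial V] (hC : IsCliffordCode ε P F)
    (hJ : IsClifford_s11 ε J) (hB : IsSkewFamily B J) (hnd : ∀ v, (∀ w, B v w = 0) → v = 0) :
    ∃ v, (∀ k, word J (P k) v = v) ∧ B v v ≠ 0 := by
  classical
  have hPP : ∀ k k' x, word J (P k) (word J (P k') x) = word J (P k') (word J (P k) x) := by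
    intro k k' x
    have := LinearMap.congr_fun (hJ.word_mul_word (hC.length k) (P k')) x
    simpa [hC.comm, paritySign] using this.symm
  have hPsq : ∀ k x, word J (P k) (word J (P k) x) = x := fun k x =>
    LinearMap.congr_fun (hJ.four_mul_self (hC.length k) (hC.nodup k) (hC.sign k)) x
  have key : ∀ s : Finset κ, (∃ x, x ≠ 0 ∧ ∀ k ∈ s, word J (P k) x = x) ∧
      ∀ x, (∀ k ∈ s, word J (P k) x = x) →
        (∀ y, (∀ k ∈ s, word J (P k) y = y) → B x y = 0) → x = 0 := by
    intro s
    induction s using Finset.induction_on with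
    | empty =>
      refine ⟨?_, fun x _ h => hnd x fun w => h w (by simp)⟩
      obtain ⟨x, hx⟩ := exists_ne (0 : V)
      exact ⟨x, hx, by simp⟩
    | insert k s hks ih =>
      obtain ⟨⟨x, hx0, hx⟩, hns⟩ := ih
      have hadd : ∀ y, (∀ k' ∈ s, word J (P k') y = y) →
          ∀ k' ∈ insert k s, word J (P k') (y + word J (P k) y) = y + word J (P k) y := by
        intro y hy k' hk'
        rcases Finset.mem_insert.1 hk' with rfl | hk'
        · rw [map_add, hPsq, add_comm]
        · rw [map_add, hPP, hy k' hk']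
      constructor
      · by_cases h0 : x + word J (P k) x = 0
        · refine ⟨word J (F k) x, fun h => hx0 (hJ.word_injective (F k) (by simpa using h)), ?_⟩
          have hsw : ∀ k', word J (P k') (word J (F k) x) =
              paritySign ((F k).map (par (P k'))).sum • word J (F k) (word J (P k') x) := by
            intro k'
            have := LinearMap.congr_fun (hJ.word_mul_word (hC.length k') (F k)) x
            simp only [Module.End.mul_apply, LinearMap.smul_apply] at this
            rw [this, smul_smul, ← paritySign_add, CharTwo.add_self_eq_zero]
            simp [paritySign]
          intro k' hk'
          rcases Finset.mem_insert.1 hk' with rfl | hk'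
          · rw [hsw, hC.flip, ← neg_eq_of_add_eq_zero_right h0]
            simp [paritySign]
          · rw [hsw, hC.flip_ne k k' (by rintro rfl; exact hks hk'), hx k' hk']
            simp [paritySign]
        · exact ⟨_, h0, hadd x hx⟩
      · intro y hy hyo
        refine hns y (fun k' hk' => hy k' (Finset.mem_insert_of_mem hk')) fun z hz => ?_
        have h1 := hyo _ (hadd z hz)
        have h2 := hB.code_selfAdjoint hJ hC k y z
        rw [hy k (Finset.mem_insert_self _ _)] at h2
        rw [map_add] at h1
        linarith
  obtain ⟨⟨x, hx0, hx⟩, hns⟩ := key Finset.univ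
  by_contra! hcon
  refine hx0 (hns x hx fun y hy => ?_)
  have h1 := hcon x fun k => hx k (Finset.mem_univ k)
  have h2 := hcon y fun k => hy k (Finset.mem_univ k)
  have h3 := hcon (x + y) fun k => by
    rw [map_add, hx k (Finset.mem_univ k), hy k (Finset.mem_univ k)]
  have h4 := hB.symm x y
  simp only [map_add, LinearMap.add_apply] at h3
  linarith

end Modules

section Intertwining

variable {ι κ : Type*} {P F : κ → List ι} {ε : ι → ℝ}
  {V : Type*} [AddCommGroup V] [Module ℝ V] {B : V →ₗ[ℝ] V →ₗ[ℝ] ℝ} {J : ι → Module.End ℝ V}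
  {V' : Type*} [AddCommGroup V'] [Module ℝ V'] {B' : V' →ₗ[ℝ] V' →ₗ[ℝ] ℝ}
  {J' : ι → Module.End ℝ V'}

theorem word_prodMap_apply (l : List ι) (x : V) (y : V') :
    word (fun i => (J i).prodMap (J' i)) l (x, y) = (word J l x, word J' l y) := by
  induction l with
  | nil => simp
  | cons i t ih => simp [ih]

theorem IsClifford_s11.prodMap (hJ : IsClifford_s11 ε J) (hJ' : IsClifford_s11 ε J') :
    IsClifford_s11 (A := Module.End ℝ (V × V')) ε (fun i => (J i).prodMap (J' i)) where
  ne_zero := hJ.ne_zero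
  sq i := by
    refine LinearMap.ext fun x => Prod.ext ?_ ?_
    · simpa using LinearMap.congr_fun (hJ.sq i) x.1
    · simpa using LinearMap.congr_fun (hJ'.sq i) x.2
  anti i j hij := by
    refine LinearMap.ext fun x => Prod.ext ?_ ?_
    · simpa using LinearMap.congr_fun (hJ.anti i j hij) x.1
    · simpa using LinearMap.congr_fun (hJ'.anti i j hij) x.2

variable [Fintype ι] [DecidableEq ι]

theorem IsCliffordCode.expectation_eq (hC : IsCliffordCode ε P F) (hJ : IsClifford_s11 ε J)
    (hJ' : IsClifford_s11 ε J') (hB : IsSkewFamily B J) (hB' : IsSkewFamily B' J') {v : V} {v' : V'}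
    (hv : ∀ k, word J (P k) v = v) (hv' : ∀ k, word J' (P k) v' = v') (l : List ι) :
    B' v' v' * B (word J l v) v = B v v * B' (word J' l v') v' := by
  rcases hC.smul_or_ortho (hJ.prodMap hJ') (v := (v, v'))
    (fun k => by rw [word_prodMap_apply, hv, hv']) l with ⟨c, hc⟩ | h0
  · rw [word_prodMap_apply, Prod.smul_mk, Prod.mk.injEq] at hc
    rw [hc.1, hc.2]
    simp only [map_smul, LinearMap.smul_apply, smul_eq_mul]
    ring
  · have h1 := h0 (B.compl₁₂ (LinearMap.fst ℝ V V') (LinearMap.fst ℝ V V'))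
      ⟨fun x y => hB.symm _ _, fun i x y => hB.skew i _ _⟩
    have h2 := h0 (B'.compl₁₂ (LinearMap.snd ℝ V V') (LinearMap.snd ℝ V V'))
      ⟨fun x y => hB'.symm _ _, fun i x y => hB'.skew i _ _⟩
    rw [word_prodMap_apply] at h1 h2
    simp only [LinearMap.compl₁₂_apply, LinearMap.fst_apply, LinearMap.snd_apply] at h1 h2
    rw [h1, h2, mul_zero, mul_zero]

theorem IsCliffordCode.gram_eq (hC : IsCliffordCode ε P F) (hJ : IsClifford_s11 ε J)
    (hJ' : IsClifford_s11 ε J') (hB : IsSkewFamily B J) (hB' : IsSkewFamily B' J') {v : V} {v' : V'}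
    (hv : ∀ k, word J (P k) v = v) (hv' : ∀ k, word J' (P k) v' = v') (m : List ι) :
    ∀ l, B' v' v' * B (word J l v) (word J m v) = B v v * B' (word J' l v') (word J' m v') := by
  induction m with
  | nil => exact hC.expectation_eq hJ hJ' hB hB' hv hv'
  | cons i t ih =>
    intro l
    have h1 := hB.skew i (word J l v) (word J t v)
    have h2 := hB'.skew i (word J' l v') (word J' t v')
    have h3 := ih (i :: l)
    simp only [word_cons, Module.End.mul_apply] at h3 ⊢
    rw [h1, h2] at h3
    linarith

/-- Two nondegenerate modules generated by vectors fixed by the code are similar. -/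
theorem IsCliffordCode.exists_intertwiner (hC : IsCliffordCode ε P F) (hJ : IsClifford_s11 ε J)
    (hJ' : IsClifford_s11 ε J') (hB : IsSkewFamily B J) (hB' : IsSkewFamily B' J')
    (hnd : ∀ v, (∀ w, B v w = 0) → v = 0) (hnd' : ∀ v, (∀ w, B' v w = 0) → v = 0)
    {v : V} {v' : V'}
    (hv : ∀ k, word J (P k) v = v) (hv' : ∀ k, word J' (P k) v' = v')
    (h0 : B v v ≠ 0) (h0' : B' v' v' ≠ 0)
    (hs : Submodule.span ℝ (Set.range fun l => word J l v) = ⊤)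
    (hs' : Submodule.span ℝ (Set.range fun l => word J' l v') = ⊤) :
    ∃ A : V ≃ₗ[ℝ] V', A v = v' ∧ (∀ i x, A (J i x) = J' i (A x)) ∧
      ∃ c : ℝ, c ≠ 0 ∧ ∀ x y, B' (A x) (A y) = c * B x y := by
  set N : Submodule ℝ (V × V') :=
    Submodule.span ℝ (Set.range fun l => (word J l v, word J' l v')) with hN
  have hgram : ∀ X ∈ N, ∀ Y ∈ N, B' v' v' * B X.1 Y.1 = B v v * B' X.2 Y.2 := by
    intro X hX Y hY
    induction hX, hY using Submodule.span_induction₂ with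
    | mem_mem x y hx hy =>
      obtain ⟨l, rfl⟩ := hx
      obtain ⟨m, rfl⟩ := hy
      exact hC.gram_eq hJ hJ' hB hB' hv hv' m l
    | zero_left y hy => simp
    | zero_right x hx => simp
    | add_left x y z _ _ _ h1 h2 => simp [mul_add, h1, h2]
    | add_right x y z _ _ _ h1 h2 => simp [mul_add, h1, h2]
    | smul_left r x y _ _ h => simp [mul_left_comm, h]
    | smul_right r x y _ _ h => simp [mul_left_comm, h]
  have hsurj : ∀ x, ∃ y, (x, y) ∈ N := by
    intro x
    have hx : x ∈ N.map (LinearMap.fst ℝ V V') := by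
      rw [hN, Submodule.map_span, ← Set.range_comp]
      exact hs ▸ Submodule.mem_top
    obtain ⟨X, hX, rfl⟩ := hx
    exact ⟨X.2, hX⟩
  have hsurj' : ∀ y, ∃ x, (x, y) ∈ N := by
    intro x
    have hx : x ∈ N.map (LinearMap.snd ℝ V V') := by
      rw [hN, Submodule.map_span, ← Set.range_comp]
      exact hs' ▸ Submodule.mem_top
    obtain ⟨X, hX, rfl⟩ := hx
    exact ⟨X.1, hX⟩
  have hb1 : Function.Bijective ((LinearMap.fst ℝ V V').domRestrict N) := by
    constructor
    · rw [injective_iff_map_eq_zero]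
      rintro ⟨⟨x, y⟩, hX⟩ (rfl : x = 0)
      have : y = 0 := hnd' y fun w => by
        obtain ⟨z, hz⟩ := hsurj' w
        simpa [h0] using (hgram _ hX _ hz).symm
      subst this
      rfl
    · intro x
      obtain ⟨y, hy⟩ := hsurj x
      exact ⟨⟨_, hy⟩, rfl⟩
  have hb2 : Function.Bijective ((LinearMap.snd ℝ V V').domRestrict N) := by
    constructor
    · rw [injective_iff_map_eq_zero]
      rintro ⟨⟨x, y⟩, hX⟩ (rfl : y = 0)
      have : x = 0 := hnd x fun w => by
        obtain ⟨z, hz⟩ := hsurj w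
        simpa [h0'] using hgram _ hX _ hz
      subst this
      rfl
    · intro y
      obtain ⟨x, hx⟩ := hsurj' y
      exact ⟨⟨_, hx⟩, rfl⟩
  set A := (LinearEquiv.ofBijective _ hb1).symm.trans (LinearEquiv.ofBijective _ hb2) with hA
  have hAN : ∀ X ∈ N, A X.1 = X.2 := by
    intro X hX
    have : (LinearEquiv.ofBijective _ hb1).symm X.1 = ⟨X, hX⟩ := by
      rw [LinearEquiv.symm_apply_eq]; rfl
    rw [hA, LinearEquiv.trans_apply, this]
    rfl
  have hgraph : ∀ x, (x, A x) ∈ N := by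
    intro x
    obtain ⟨y, hy⟩ := hsurj x
    rwa [hAN _ hy]
  have hclosed : ∀ i, ∀ X ∈ N, (J i X.1, J' i X.2) ∈ N := by
    intro i X hX
    have hle : N ≤ N.comap ((J i).prodMap (J' i)) := by
      rw [hN, Submodule.span_le]
      rintro _ ⟨l, rfl⟩
      exact Submodule.subset_span ⟨i :: l, by simp⟩
    exact hle hX
  refine ⟨A, hAN (v, v') (Submodule.subset_span ⟨[], rfl⟩),
    fun i x => hAN _ (hclosed i _ (hgraph x)), B' v' v' / B v v, div_ne_zero h0' h0,
    fun x y => ?_⟩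
  have := hgram _ (hgraph x) _ (hgraph y)
  field_simp
  linarith

theorem IsCliffordCode.neg (hC : IsCliffordCode ε P F) :
    IsCliffordCode (fun i => -ε i) P F :=
  { hC with
    sign := fun k => by
      have h1 := hC.sign k
      obtain ⟨a, b, c, d, h⟩ := List.length_eq_four.1 (hC.length k)
      rw [h] at h1 ⊢
      simpa using h1 }

/-- Similar modules of opposite signatures carry proportional families of alternating forms. -/
theorem IsCliffordCode.exists_transposition (hC : IsCliffordCode ε P F) (hJ : IsClifford_s11 ε J)
    (hJ' : IsClifford_s11 (fun i => -ε i) J') (hB : IsSkewFamily B J) (hB' : IsSkewFamily B' J')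
    (hnd : ∀ v, (∀ w, B v w = 0) → v = 0) (hnd' : ∀ v, (∀ w, B' v w = 0) → v = 0)
    {v : V} {v' : V'}
    (hv : ∀ k, word J (P k) v = v) (hv' : ∀ k, word J' (P k) v' = v')
    (h0 : B v v ≠ 0) (h0' : B' v' v' ≠ 0)
    (hs : Submodule.span ℝ (Set.range fun l => word J l v) = ⊤)
    (hs' : Submodule.span ℝ (Set.range fun l => word J' l v') = ⊤) :
    ∃ A : V ≃ₗ[ℝ] V', ∃ c : ℝ, c ≠ 0 ∧
      ∀ i x y, B' (J' i (A x)) (A y) = c * B (J i x) y := by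
  have hCneg := hC.neg
  have hword : ∀ l, word (fun i => -J i) l = (-1 : ℝ) ^ l.length • word J l := by
    intro l
    induction l with
    | nil => simp
    | cons i t ih => simp [ih, pow_succ]
  obtain ⟨I, hIv, hIJ, c, hc, hIB⟩ := hC.exists_intertwiner hJ (J' := fun i => -J i)
    ⟨hJ.ne_zero, fun i => by simpa using hJ.sq i, fun i j hij => by simpa using hJ.anti i j hij⟩
    hB ⟨hB.symm, fun i x y => by simpa using congrArg Neg.neg (hB.skew i x y)⟩ hnd hnd hv
    (fun k => by rw [hword, hC.length]; norm_num [hv]) h0 h0 hs (by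
      rw [eq_top_iff, ← hs, Submodule.span_le]
      rintro _ ⟨l, rfl⟩
      have : word J l v = (-1 : ℝ) ^ l.length • word (fun i => -J i) l v := by
        rw [hword, LinearMap.smul_apply, smul_smul, ← mul_pow]
        simp
      rw [SetLike.mem_coe]
      simp only [this]
      exact Submodule.smul_mem _ _ (Submodule.subset_span ⟨l, rfl⟩))
  have hc1 : c = 1 := by
    have := hIB v v
    rw [hIv] at this
    exact mul_right_cancel₀ h0 (by linarith)
  subst hc1
  simp only [LinearMap.neg_apply] at hIJ
  have hII : ∀ x, I (I x) = x := by
    intro x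
    have hx : x ∈ Submodule.span ℝ (Set.range fun l => word J l v) := hs ▸ Submodule.mem_top
    induction hx using Submodule.span_induction with
    | mem x hx =>
      obtain ⟨l, rfl⟩ := hx
      induction l with
      | nil => simp [hIv]
      | cons i t ih => simpa [hIJ] using congrArg (J i) ih
    | zero => simp
    | add x y _ _ hx hy => simp [hx, hy]
    | smul r x _ hx => simp [hx]
  have hIsymm : ∀ x y, B (I x) y = B x (I y) := by
    intro x y
    have := hIB x (I y)
    rwa [hII, one_mul] at this
  have hwordI : ∀ l : List ι, ∃ s : ℝ, s * s = 1 ∧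
      word (fun i => (I : V →ₗ[ℝ] V) * J i) l v = s • word J l v ∧
      I (word J l v) = (-1 : ℝ) ^ l.length • word J l v := by
    intro l
    induction l with
    | nil => exact ⟨1, by simp [hIv]⟩
    | cons i t ih =>
      obtain ⟨s, hs, h1, h2⟩ := ih
      refine ⟨s * (-1) ^ (t.length + 1), ?_, ?_, ?_⟩
      · rw [mul_mul_mul_comm, hs, ← mul_pow]; simp
      · simp [h1, h2, hIJ, pow_succ, mul_smul]
      · simp [hIJ, h2, pow_succ]
  have hI4 : ∀ l : List ι, l.length = 4 →
      word (fun i => (I : V →ₗ[ℝ] V) * J i) l v = word J l v := by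
    intro l hl
    obtain ⟨a, b, c, d, rfl⟩ := List.length_eq_four.1 hl
    simp [hIJ, hIv]
  obtain ⟨A, -, hAJ, d, hd, hAB⟩ := hCneg.exists_intertwiner
    (B := B ∘ₗ (I : V →ₗ[ℝ] V)) (J := fun i => (I : V →ₗ[ℝ] V) * J i) (v := v)
    ⟨hJ'.ne_zero, fun i => LinearMap.ext fun x => by
      have := LinearMap.congr_fun (hJ.sq i) x
      simp only [Module.End.mul_apply, LinearMap.smul_apply, Module.End.one_apply] at this
      simp [hIJ, hII, this], fun i j hij => LinearMap.ext fun x => by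
      have := LinearMap.congr_fun (hJ.anti i j hij) x
      simp only [Module.End.mul_apply, LinearMap.neg_apply] at this
      simp [hIJ, hII, this]⟩ hJ'
    ⟨fun x y => by simpa using (hIsymm x y).trans (hB.symm _ _), fun i x y => by
      have := hB.skew i x (I (I y))
      simp only [hII] at this
      simp [hIsymm, hII, hIJ, this]
      ⟩ hB'
    (fun x hx => by
      have : I x = 0 := hnd _ fun w => by simpa using hx w
      simpa using this) hnd'
    (fun k => (hI4 _ (hC.length k)).trans (hv k)) hv' (by simpa [hIv] using h0) h0' (by
      rw [eq_top_iff, ← hs, Submodule.span_le]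
      rintro _ ⟨l, rfl⟩
      obtain ⟨s, hss, h1, -⟩ := hwordI l
      have : word J l v = s • word (fun i => (I : V →ₗ[ℝ] V) * J i) l v := by
        rw [h1, smul_smul, hss, one_smul]
      rw [SetLike.mem_coe]
      simp only [this]
      exact Submodule.smul_mem _ _ (Submodule.subset_span ⟨l, rfl⟩)) hs'
  refine ⟨A, d, hd, fun i x y => ?_⟩
  rw [← hAJ, hAB]
  simp [hII]

end Intertwining

section Minimal

variable {ι κ : Type*} {P F : κ → List ι} {ε : ι → ℝ} {r s : ℕ}
  {V : Type} [AddCommGroup V] [Module ℝ V] {B : V →ₗ[ℝ] V →ₗ[ℝ] ℝ}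
  {J : (Fin (r + s) → ℝ) →ₗ[ℝ] V →ₗ[ℝ] V}

/-- The standard generators of a Clifford module, indexed through `e`. -/
def generators (J : (Fin (r + s) → ℝ) →ₗ[ℝ] V →ₗ[ℝ] V) (e : ι ≃ Fin (r + s)) (i : ι) :
    Module.End ℝ V := J (Pi.single (e i) 1)

theorem sform_single (e : ι ≃ Fin (r + s))
    (he : ∀ i, ε i = if (e i : ℕ) < r then 1 else -1) (i : ι) (W : Fin (r + s) → ℝ) :
    sform r s (Pi.single (e i) 1) W = ε i * W (e i) := by
  rw [sform, Finset.sum_eq_single (e i)]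
  · simp [he]
  · intro b _ hb; simp [hb]
  · simp

theorem IsAdmissible.isClifford (h : IsAdmissible r s V B J) (e : ι ≃ Fin (r + s))
    (he : ∀ i, ε i = if (e i : ℕ) < r then 1 else -1) :
    IsClifford_s11 ε (generators J e) := by
  obtain ⟨-, -, -, -, hsq, -⟩ := h
  refine ⟨fun _ => by rw [he]; split_ifs <;> norm_num, fun i => LinearMap.ext fun x => ?_,
    fun i j hij => LinearMap.ext fun x => ?_⟩
  · have := hsq (Pi.single (e i) 1) x
    rw [sform_single e he] at this
    simpa [generators] using this
  · have hij' : e i ≠ e j := fun h => hij (e.injective h)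
    have h1 := hsq (Pi.single (e i) 1) x
    have h2 := hsq (Pi.single (e j) 1) x
    have h3 := hsq (Pi.single (e i) 1 + Pi.single (e j) 1) x
    have h4 : sform r s (Pi.single (e i) 1 + Pi.single (e j) 1)
        (Pi.single (e i) 1 + Pi.single (e j) 1) = ε i + ε j := by
      have hadd : ∀ X Y W : Fin (r + s) → ℝ,
          sform r s (X + Y) W = sform r s X W + sform r s Y W := by
        intro X Y W
        simp only [sform, Pi.add_apply, ← Finset.sum_add_distrib]
        exact Finset.sum_congr rfl fun _ _ => by ring
      rw [hadd, sform_single e he, sform_single e he]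
      simp [hij', hij'.symm]
    rw [sform_single e he] at h1 h2
    rw [h4] at h3
    simp only [map_add, LinearMap.add_apply, h1, h2, Pi.single_eq_same, mul_one] at h3
    have h5 : J (Pi.single (e i) 1) (J (Pi.single (e j) 1) x)
        + J (Pi.single (e j) 1) (J (Pi.single (e i) 1) x) = 0 := by
      rw [← sub_eq_zero] at h3
      rw [← h3]
      module
    simpa [generators] using eq_neg_of_add_eq_zero_left h5

theorem IsAdmissible.isSkewFamily (h : IsAdmissible r s V B J) (e : ι ≃ Fin (r + s)) :
    IsSkewFamily B (generators J e) :=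
  ⟨h.2.2.1, fun _ v w => h.2.2.2.2.2 _ v w⟩

variable [Fintype ι]

theorem eq_sum_generators (J : (Fin (r + s) → ℝ) →ₗ[ℝ] V →ₗ[ℝ] V) (e : ι ≃ Fin (r + s))
    (Z : Fin (r + s) → ℝ) : J Z = ∑ i, Z (e i) • generators J e i := by
  conv_lhs => rw [← Finset.univ_sum_single Z, map_sum, ← e.sum_comp]
  refine Finset.sum_congr rfl fun i _ => ?_
  rw [generators, ← map_smul, ← Pi.single_smul, smul_eq_mul, mul_one]

variable [DecidableEq ι]

theorem IsMinimalAdmissible.span_eq_top (hC : IsCliffordCode ε P F)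
    (h : IsMinimalAdmissible r s V B J) (e : ι ≃ Fin (r + s))
    (he : ∀ i, ε i = if (e i : ℕ) < r then 1 else -1) {v : V}
    (hv : ∀ k, word (generators J e) (P k) v = v) (h0 : B v v ≠ 0) :
    Submodule.span ℝ (Set.range fun l => word (generators J e) l v) = ⊤ := by
  obtain ⟨hadm, hmin⟩ := h
  have hcl := hadm.isClifford e he
  have hsk := hadm.isSkewFamily e
  obtain ⟨hfd, -, hsymm, -, hsq, hskew⟩ := hadm
  set S := Set.range fun l => word (generators J e) l v with hS
  set N := Submodule.span ℝ S with hN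
  have hJN : ∀ Z, ∀ x ∈ N, J Z x ∈ N := by
    intro Z x hx
    rw [eq_sum_generators J e, LinearMap.sum_apply]
    refine Submodule.sum_mem _ fun i _ => Submodule.smul_mem _ _ ?_
    have hle : N ≤ N.comap (generators J e i) := by
      rw [hN, Submodule.span_le]
      rintro _ ⟨l, rfl⟩
      exact Submodule.subset_span ⟨i :: l, by simp⟩
    exact hle hx
  have hvN : v ∈ N := Submodule.subset_span ⟨[], rfl⟩
  have hself : ∀ a ∈ S, B a a ≠ 0 := by
    rintro _ ⟨l, rfl⟩
    obtain ⟨c, hc, hl⟩ := hcl.mul_reverse l.reverse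
    rw [List.reverse_reverse] at hl
    have := LinearMap.congr_fun hl v
    simp only [Module.End.mul_apply, LinearMap.smul_apply, Module.End.one_apply] at this
    simp only
    rw [hsk.word_left, this]
    simp [hc, h0]
  have hpair : ∀ a ∈ S, ∀ b ∈ S, B a b = 0 ∨ ∃ c : ℝ, a = c • b := by
    rintro _ ⟨l, rfl⟩ _ ⟨m, rfl⟩
    rcases hC.smul_or_ortho hcl hv (m.reverse ++ l) with ⟨c, hc⟩ | h0
    · obtain ⟨d, hd, hm⟩ := hcl.mul_reverse m
      rw [word_append, Module.End.mul_apply] at hc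
      have h1 := congrArg (fun x => word (generators J e) m x) hc
      have h2 := LinearMap.congr_fun hm (word (generators J e) l v)
      simp only [Module.End.mul_apply, LinearMap.smul_apply, Module.End.one_apply,
        map_smul] at h1 h2
      rw [h2] at h1
      refine .inr ⟨d⁻¹ * c, ?_⟩
      simp only
      rw [mul_smul, ← h1, smul_smul, inv_mul_cancel₀ hd, one_smul]
    · left
      have h1 := h0 B hsk
      rw [word_append, Module.End.mul_apply, hsk.word_left, List.reverse_reverse] at h1
      simpa using h1
  have hnd : ∀ x ∈ N, (∀ y ∈ N, B x y = 0) → x = 0 := by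
    classical
    obtain ⟨b, hbS, hbspan, hbli⟩ := exists_linearIndependent ℝ S
    have hortho : ∀ i j : b, i ≠ j → B (i : V) j = 0 := by
      intro i j hij
      rcases hpair i (hbS i.2) j (hbS j.2) with h | ⟨c, hc⟩
      · exact h
      · have := (linearIndependent_iff'.1 hbli) ({i, j} : Finset b) (fun k => if k = i then 1 else -c)
          (by rw [Finset.sum_pair hij]; simp [hij.symm, ← hc]) i (by simp)
        simp at this
    intro x hx hxo
    rw [hN, ← hbspan] at hx
    have hx' : x ∈ Submodule.span ℝ (Set.range ((↑) : b → V)) := by simpa using hx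
    obtain ⟨f, rfl⟩ := Finsupp.mem_span_range_iff_exists_finsupp.1 hx'
    rw [Finsupp.sum] at hxo ⊢
    refine Finset.sum_eq_zero fun i hi => ?_
    have h1 := hxo i (Submodule.subset_span (hbS i.2))
    rw [map_sum, LinearMap.sum_apply, Finset.sum_eq_single i] at h1
    · have : f i = 0 := by simpa [hself i (hbS i.2)] using h1
      simp [this]
    · intro j _ hj
      simp [hortho j i hj]
    · intro h; exact absurd hi h
  have hle := hmin N (B.domRestrict₁₂ N N)
    (LinearMap.mk₂ ℝ (fun Z (x : N) => (⟨J Z x, hJN Z x x.2⟩ : N))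
      (fun _ _ _ => by ext; simp) (fun _ _ _ => by ext; simp) (fun _ _ _ => by ext; simp)
      (fun _ _ _ => by ext; simp))
    ⟨inferInstance, ⟨⟨⟨v, hvN⟩, 0, fun h => h0 (by
        rw [show v = 0 from congrArg Subtype.val h]; simp)⟩⟩,
      fun x y => hsymm _ _,
      fun x hx => Subtype.ext (hnd x x.2 fun y hy => hx ⟨y, hy⟩),
      fun Z x => Subtype.ext (hsq Z x), fun Z x y => hskew Z x y⟩
  exact Submodule.eq_top_of_finrank_eq (le_antisymm (Submodule.finrank_le N) hle)

end Minimal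

/-- There is a code for the signature `(p, q)`. -/
def HasCliffordCode (p q : ℕ) : Prop :=
  ∃ (ι κ : Type) (_ : Fintype ι) (_ : DecidableEq ι) (_ : Fintype κ)
    (P F : κ → List ι) (e : ι ≃ Fin p ⊕ Fin q),
    IsCliffordCode (fun i => Sum.elim (fun _ => 1) (fun _ => -1) (e i)) P F

theorem HasCliffordCode.exists_lieIso {p q : ℕ} (hcode : HasCliffordCode p q)
    (V1 : Type) [AddCommGroup V1] [Module ℝ V1] (B1 : V1 →ₗ[ℝ] V1 →ₗ[ℝ] ℝ)
    (J1 : (Fin (p + q) → ℝ) →ₗ[ℝ] V1 →ₗ[ℝ] V1) (br1 : V1 →ₗ[ℝ] V1 →ₗ[ℝ] (Fin (p + q) → ℝ))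
    (hadm1 : IsMinimalAdmissible p q V1 B1 J1) (hbr1 : IsHBracket p q V1 B1 J1 br1)
    (V2 : Type) [AddCommGroup V2] [Module ℝ V2] (B2 : V2 →ₗ[ℝ] V2 →ₗ[ℝ] ℝ)
    (J2 : (Fin (q + p) → ℝ) →ₗ[ℝ] V2 →ₗ[ℝ] V2) (br2 : V2 →ₗ[ℝ] V2 →ₗ[ℝ] (Fin (q + p) → ℝ))
    (hadm2 : IsMinimalAdmissible q p V2 B2 J2) (hbr2 : IsHBracket q p V2 B2 J2 br2) :
    ∃ f : (V1 × (Fin (p + q) → ℝ)) ≃ₗ[ℝ] (V2 × (Fin (q + p) → ℝ)), IsLieIso br1 br2 f := by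
  obtain ⟨ι, κ, _, _, _, P, F, e, hC⟩ := hcode
  set ε : ι → ℝ := fun i => Sum.elim (fun _ => 1) (fun _ => -1) (e i) with hε
  set e1 : ι ≃ Fin (p + q) := e.trans finSumFinEquiv with he1
  set e2 : ι ≃ Fin (q + p) := (e.trans (Equiv.sumComm _ _)).trans finSumFinEquiv with he2
  have hs1 : ∀ i, ε i = if (e1 i : ℕ) < p then 1 else -1 := by
    intro i
    simp only [hε, he1, Equiv.trans_apply]
    rcases e i with a | a <;> simp
  have hs2 : ∀ i, -ε i = if (e2 i : ℕ) < q then 1 else -1 := by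
    intro i
    simp only [hε, he2, Equiv.trans_apply]
    rcases e i with a | a <;> simp
  have hCneg := hC.neg
  have := hadm1.1.2.1
  have := hadm2.1.2.1
  have hcl1 := hadm1.1.isClifford e1 hs1
  have hcl2 := hadm2.1.isClifford e2 hs2
  have hsk1 := hadm1.1.isSkewFamily e1
  have hsk2 := hadm2.1.isSkewFamily e2
  have hnd1 := hadm1.1.2.2.2.1
  have hnd2 := hadm2.1.2.2.2.1
  obtain ⟨v1, hv1, h01⟩ := hC.exists_fixed_vector hcl1 hsk1 hnd1
  obtain ⟨v2, hv2, h02⟩ := hCneg.exists_fixed_vector hcl2 hsk2 hnd2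
  obtain ⟨A, c, hc, hA⟩ := hC.exists_transposition hcl1 hcl2 hsk1 hsk2 hnd1 hnd2 hv1 hv2 h01 h02
    (hadm1.span_eq_top hC e1 hs1 hv1 h01) (hadm2.span_eq_top hCneg e2 hs2 hv2 h02)
  refine ⟨A.prodCongr ((LinearEquiv.funCongrLeft ℝ ℝ (e2.symm.trans e1)).trans
    (LinearEquiv.smulOfNeZero ℝ _ (-c) (neg_ne_zero.2 hc))), fun x y => ?_⟩
  refine Prod.ext (by simp) (funext fun j => ?_)
  obtain ⟨i, rfl⟩ := e2.surjective j
  have h1 := hbr1 (Pi.single (e1 i) 1) x.1 y.1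
  have h2 := hbr2 (Pi.single (e2 i) 1) (A x.1) (A y.1)
  rw [sform_single e1 hs1] at h1
  rw [sform_single (ε := fun i => -ε i) e2 hs2] at h2
  have h3 := hA i x.1 y.1
  simp only [generators] at h3
  rw [h3, ← h1] at h2
  have hε0 := hcl1.ne_zero i
  simp only [LinearEquiv.funCongrLeft_comp, LinearEquiv.prodCongr_apply, map_zero,
    LinearEquiv.trans_apply, LinearEquiv.funCongrLeft_apply, LinearEquiv.smulOfNeZero_apply, neg_smul,
    Pi.neg_apply, Pi.smul_apply, LinearMap.funLeft_apply, Equiv.symm_apply_apply, smul_eq_mul]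
  refine mul_left_cancel₀ hε0 ?_
  linarith

section Codes

theorem par_map_of_injective {α β : Type*} [DecidableEq α] [DecidableEq β] {g : α → β}
    (hg : Function.Injective g) (l : List α) (a : α) : par (l.map g) (g a) = par l a := by
  rw [par, List.count_map_of_injective l g hg, par]

theorem par_map_of_notMem {α β : Type*} [DecidableEq β] {g : α → β} {b : β}
    (hb : ∀ a, g a ≠ b) (l : List α) : par (l.map g) b = 0 := by
  rw [par, List.count_eq_zero_of_not_mem (by simpa using fun a _ => hb a), Nat.cast_zero]

/-- Generators of the extended Hamming code. -/
def hamming : Fin 4 → List (Fin 8) := ![[0, 1, 2, 3], [0, 1, 4, 5], [0, 1, 6, 7], [0, 2, 4, 6]]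

/-- Words dual to the generators of the extended Hamming code. -/
def hammingDual : Fin 4 → List (Fin 8) := ![[3], [5], [7], [6, 7]]

theorem sum_filter_eq_one {κ : Type*} [Fintype κ] (x y : κ → ZMod 2) :
    ∑ k ∈ Finset.univ.filter (fun k => x k = 1), y k = ∑ k, x k * y k := by
  rw [Finset.sum_filter]
  refine Finset.sum_congr rfl fun k _ => ?_
  generalize x k = a
  generalize y k = b
  revert a b
  decide

theorem par_hamming : ∀ k, par (hamming k) =
    ![![1, 1, 1, 1, 0, 0, 0, 0], ![1, 1, 0, 0, 1, 1, 0, 0], ![1, 1, 0, 0, 0, 0, 1, 1],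
      ![1, 0, 1, 0, 1, 0, 1, 0]] k := by decide

theorem hamming_complete (f : Fin 8 → ZMod 2) (hf : ∀ k, ∑ i, f i * par (hamming k) i = 0) :
    ∃ s : Finset (Fin 4), ∀ i, f i + ∑ k ∈ s, par (hamming k) i = 0 := by
  refine ⟨Finset.univ.filter (fun k => ![f 3, f 5, f 7, f 6 + f 7] k = 1), fun i => ?_⟩
  rw [sum_filter_eq_one _ fun k => par (hamming k) i]
  have h0 := hf 0
  have h1 := hf 1
  have h2 := hf 2
  have h3 := hf 3
  simp only [par_hamming, Fin.sum_univ_eight, Fin.sum_univ_four] at h0 h1 h2 h3 ⊢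
  fin_cases i <;> simp at h0 h1 h2 h3 ⊢ <;> clear hf <;> grind

theorem HasCliffordCode.add_block {a b p q : ℕ} (e₀ : Fin 8 ≃ Fin a ⊕ Fin b)
    (hsign : ∀ k, ((hamming k).map fun i =>
      (Sum.elim (fun _ => 1) (fun _ => -1) (e₀ i) : ℝ)).prod = 1)
    (h : HasCliffordCode p q) : HasCliffordCode (p + a) (q + b) := by
  obtain ⟨ι, κ, _, _, _, P, F, e, hC⟩ := h
  have hl : Function.Injective (Sum.inl : ι → ι ⊕ Fin 8) := Sum.inl_injective
  have hr : Function.Injective (Sum.inr : Fin 8 → ι ⊕ Fin 8) := Sum.inr_injective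
  have hlr : ∀ (l : List ι) j, par (l.map Sum.inl) (Sum.inr j : ι ⊕ Fin 8) = 0 := fun l j =>
    par_map_of_notMem (by simp) l
  have hrl : ∀ (l : List (Fin 8)) j, par (l.map Sum.inr) (Sum.inl j : ι ⊕ Fin 8) = 0 :=
    fun l j => par_map_of_notMem (by simp) l
  refine ⟨ι ⊕ Fin 8, κ ⊕ Fin 4, inferInstance, inferInstance, inferInstance,
    Sum.elim (fun k => (P k).map Sum.inl) (fun k => (hamming k).map Sum.inr),
    Sum.elim (fun k => (F k).map Sum.inl) (fun k => (hammingDual k).map Sum.inr),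
    (e.sumCongr e₀).trans ((Equiv.sumSumSumComm _ _ _ _).trans
      (finSumFinEquiv.sumCongr finSumFinEquiv)), ?_⟩
  have hll : ∀ (l : List ι) j, par (l.map Sum.inl) (Sum.inl j : ι ⊕ Fin 8) = par l j := fun l j =>
    par_map_of_injective hl l j
  have hrr : ∀ (l : List (Fin 8)) j, par (l.map Sum.inr) (Sum.inr j : ι ⊕ Fin 8) = par l j :=
    fun l j => par_map_of_injective hr l j
  constructor
  · rintro (k | k)
    · simpa using hC.length k
    · revert k; simp; decide
  · rintro (k | k)
    · exact (hC.nodup k).map hl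
    · refine List.Nodup.map hr ?_
      revert k; decide
  · rintro (k | k)
    · refine Eq.trans ?_ (hC.sign k)
      rw [Sum.elim_inl, List.map_map]
      congr 2
      funext i
      simp only [Function.comp, Equiv.trans_apply, Equiv.sumCongr_apply, Sum.map_inl]
      rcases e i with x | x <;> simp
    · refine Eq.trans ?_ (hsign k)
      rw [Sum.elim_inr, List.map_map]
      congr 2
      funext i
      simp only [Function.comp, Equiv.trans_apply, Equiv.sumCongr_apply, Sum.map_inr]
      rcases e₀ i with x | x <;> simp
  · rintro (k | k) (k' | k') <;>
      simp only [Sum.elim_inl, Sum.elim_inr, List.map_map, Function.comp_def, hll, hlr, hrl, hrr]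
    · exact hC.comm k k'
    · simp
    · simp
    · revert k k'; decide
  · rintro (k | k) <;>
      simp only [Sum.elim_inl, Sum.elim_inr, List.map_map, Function.comp_def, hll, hrr]
    · exact hC.flip k
    · revert k; decide
  · rintro (k | k) (k' | k') hk <;>
      simp only [Sum.elim_inl, Sum.elim_inr, List.map_map, Function.comp_def, hll, hlr, hrl, hrr]
    · exact hC.flip_ne k k' (by simpa using hk)
    · simp
    · simp
    · replace hk : k ≠ k' := by simpa using hk
      revert k k'; decide
  · intro f hf
    obtain ⟨R, hR, s, hs⟩ := hC.complete (fun i => f (.inl i)) fun k => by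
      simpa [hll, hlr] using hf (.inl k)
    obtain ⟨t, ht⟩ := hamming_complete (fun i => f (.inr i)) fun k => by
      simpa [hrr, hrl] using hf (.inr k)
    refine ⟨R.map Sum.inl, ?_, s.disjSum t, ?_⟩
    · rcases hR with rfl | ⟨i, rfl⟩ | ⟨i, j, hij, rfl⟩
      · exact .inl rfl
      · exact .inr (.inl ⟨.inl i, rfl⟩)
      · exact .inr (.inr ⟨.inl i, .inl j, by simpa using hij, rfl⟩)
    · rintro (i | i) <;> rw [Finset.sum_disjSum] <;>
        simp only [Sum.elim_inl, Sum.elim_inr, hll, hlr, hrl, hrr]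
      · simpa using hs i
      · simpa using ht i

theorem HasCliffordCode.add_eight_left {p q : ℕ} (h : HasCliffordCode p q) :
    HasCliffordCode (p + 8) q :=
  h.add_block (Equiv.sumEmpty (Fin 8) (Fin 0)).symm fun k => by simp

theorem HasCliffordCode.add_eight_right {p q : ℕ} (h : HasCliffordCode p q) :
    HasCliffordCode p (q + 8) :=
  h.add_block (Equiv.emptySum (Fin 0) (Fin 8)).symm fun k => by
    fin_cases k <;> simp [hamming]

theorem HasCliffordCode.add_four_four {p q : ℕ} (h : HasCliffordCode p q) :
    HasCliffordCode (p + 4) (q + 4) :=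
  h.add_block (finSumFinEquiv (m := 4) (n := 4)).symm fun k => by
    have hs : ∀ i : Fin 8, (Sum.elim (fun _ => 1) (fun _ => -1)
        ((finSumFinEquiv (m := 4) (n := 4)).symm i) : ℝ) = if i < 4 then 1 else -1 := by
      intro i
      fin_cases i <;> rfl
    simp only [hs]
    fin_cases k <;> simp [hamming]

theorem hasCliffordCode_of_le_two {n : ℕ} (hn : n ≤ 2) : HasCliffordCode n 0 := by
  refine ⟨Fin n, Empty, inferInstance, inferInstance, inferInstance, nofun, nofun,
    (Equiv.sumEmpty (Fin n) (Fin 0)).symm, nofun, nofun, nofun, nofun, nofun, nofun, ?_⟩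
  intro f _
  have key : f = 0 ∨ (∃ i, ∀ k, par [i] k + f k = 0) ∨
      ∃ i j, i ≠ j ∧ ∀ k, par [i, j] k + f k = 0 := by
    revert f
    interval_cases n <;> decide
  rcases key with rfl | ⟨i, hi⟩ | ⟨i, j, hij, h⟩
  · exact ⟨[], .inl rfl, ∅, by simp [par]⟩
  · exact ⟨[i], .inr (.inl ⟨i, rfl⟩), ∅, by simpa using hi⟩
  · exact ⟨[i, j], .inr (.inr ⟨i, j, hij, rfl⟩), ∅, by simpa using h⟩

theorem hasCliffordCode_four : HasCliffordCode 4 0 := by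
  refine ⟨Fin 4, Unit, inferInstance, inferInstance, inferInstance, fun _ => [0, 1, 2, 3],
    fun _ => [0], (Equiv.sumEmpty (Fin 4) (Fin 0)).symm, by simp, by simp, by simp, by decide,
    by decide, by simp, ?_⟩
  intro f hf
  have key : f = 0 ∨ (∀ k, f k + par [0, 1, 2, 3] k = 0) ∨
      ∃ i j, i ≠ j ∧ ∀ k, par [i, j] k + f k = 0 := by
    replace hf := hf ()
    revert f
    decide
  rcases key with rfl | h | ⟨i, j, hij, h⟩
  · exact ⟨[], .inl rfl, ∅, by simp [par]⟩
  · exact ⟨[], .inl rfl, {()}, by simpa [par] using h⟩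
  · exact ⟨[i, j], .inr (.inr ⟨i, j, hij, rfl⟩), ∅, by simpa using h⟩

theorem hasCliffordCode (r t₁ t₂ t₃ : ℕ)
    (hr : r % 8 = 0 ∨ r % 8 = 1 ∨ r % 8 = 2 ∨ r % 8 = 4) :
    HasCliffordCode (r + 4 * t₁ + 8 * t₂) (8 * t₃ + 4 * t₁) := by
  have h0 : HasCliffordCode (r % 8) 0 := by
    rcases hr with h | h | h | h <;> rw [h]
    · exact hasCliffordCode_of_le_two (by norm_num)
    · exact hasCliffordCode_of_le_two (by norm_num)
    · exact hasCliffordCode_of_le_two (by norm_num)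
    · exact hasCliffordCode_four
  have h1 : ∀ n, HasCliffordCode (r % 8 + 8 * n) 0 := fun n => by
    induction n with
    | zero => exact h0
    | succ n ih => exact ih.add_eight_left
  have h2 : ∀ n m, HasCliffordCode (r % 8 + 8 * n) (8 * m) := fun n m => by
    induction m with
    | zero => exact h1 n
    | succ m ih => exact ih.add_eight_right
  have h3 : ∀ n m k, HasCliffordCode (r % 8 + 8 * n + 4 * k) (8 * m + 4 * k) := fun n m k => by
    induction k with
    | zero => exact h2 n m
    | succ k ih => exact ih.add_four_four
  have := h3 (r / 8 + t₂) t₃ t₁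
  rwa [show r % 8 + 8 * (r / 8 + t₂) + 4 * t₁ = r + 4 * t₁ + 8 * t₂ by omega] at this

end Codes

theorem stmt11 (r t₁ t₂ t₃ : ℕ)
    (hr : r % 8 = 0 ∨ r % 8 = 1 ∨ r % 8 = 2 ∨ r % 8 = 4)
    (V1 : Type) [AddCommGroup V1] [Module ℝ V1]
    (B1 : V1 →ₗ[ℝ] V1 →ₗ[ℝ] ℝ)
    (J1 : (Fin ((r + 4 * t₁ + 8 * t₂) + (8 * t₃ + 4 * t₁)) → ℝ) →ₗ[ℝ] V1 →ₗ[ℝ] V1)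
    (br1 : V1 →ₗ[ℝ] V1 →ₗ[ℝ] (Fin ((r + 4 * t₁ + 8 * t₂) + (8 * t₃ + 4 * t₁)) → ℝ))
    (hadm1 : IsMinimalAdmissible (r + 4 * t₁ + 8 * t₂) (8 * t₃ + 4 * t₁) V1 B1 J1)
    (hbr1 : IsHBracket (r + 4 * t₁ + 8 * t₂) (8 * t₃ + 4 * t₁) V1 B1 J1 br1)
    (V2 : Type) [AddCommGroup V2] [Module ℝ V2]
    (B2 : V2 →ₗ[ℝ] V2 →ₗ[ℝ] ℝ)
    (J2 : (Fin ((8 * t₃ + 4 * t₁) + (r + 4 * t₁ + 8 * t₂)) → ℝ) →ₗ[ℝ] V2 →ₗ[ℝ] V2)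
    (br2 : V2 →ₗ[ℝ] V2 →ₗ[ℝ] (Fin ((8 * t₃ + 4 * t₁) + (r + 4 * t₁ + 8 * t₂)) → ℝ))
    (hadm2 : IsMinimalAdmissible (8 * t₃ + 4 * t₁) (r + 4 * t₁ + 8 * t₂) V2 B2 J2)
    (hbr2 : IsHBracket (8 * t₃ + 4 * t₁) (r + 4 * t₁ + 8 * t₂) V2 B2 J2 br2)
    :
    ∃ f : (V1 × (Fin ((r + 4 * t₁ + 8 * t₂) + (8 * t₃ + 4 * t₁)) → ℝ)) ≃ₗ[ℝ]
          (V2 × (Fin ((8 * t₃ + 4 * t₁) + (r + 4 * t₁ + 8 * t₂)) → ℝ)),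
      IsLieIso br1 br2 f := by
  exact (hasCliffordCode r t₁ t₂ t₃ hr).exists_lieIso V1 B1 J1 br1 hadm1 hbr1 V2 B2 J2 br2 hadm2 hbr2
end
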